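/- arXiv:1111.1538 — 6 statements merged into one kernel-verified Lean document; each statement's English description precedes it below -/
import Mathlib

section
/- Assume the amalgam setting: groups (G_λ, d_λ) with two-sided invariant metrics, a group A with injective homomorphisms φ_λ : A → G_λ having closed images and with matching metrics on A. Let P = ∐_A G_λ carry the Graev metric d̄, and let X = ⋃_λ of_λ(G_λ) ⊆ P be the union of the images of the factors, with the metric d̄ restricted to X (so 1 ∈ X). Let F be the free group with basis X ∖ {1}, let π : F → P be the unique homomorphism sending each generator x ∈ X ∖ {1} to x ∈ P, and let N = ker π. Let d_F be a two-sided invariant metric on F such that for all generators x, y ∈ X ∖ {1}: d_F(x, y) = d̄(x, y), d_F(x⁻¹, y⁻¹) = d̄(x, y), d_F(x, y⁻¹) = d̄(x, 1) + d̄(1, y), d_F(x, 1) = d̄(x, 1), and which is maximal among all two-sided invariant metrics on F with these properties. Then for every f ∈ F, d̄(π(f), 1) = inf { d_F(f·h, 1) : h ∈ N }; i.e. the quotient metric on F/N induced by d_F coincides, under the canonical isomorphism F/N ≅ P, with the Graev metric d̄. -/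
/-- A two-sided invariant metric on a group. -/
def IsTSIMetric {G : Type*} [Group G] (d : G → G → ℝ) : Prop :=
  (∀ x y : G, d x y = 0 ↔ x = y) ∧
  (∀ x y : G, d x y = d y x) ∧
  (∀ x y z : G, d x z ≤ d x y + d y z) ∧
  (∀ g x y : G, d (g * x) (g * y) = d x y) ∧
  (∀ g x y : G, d (x * g) (y * g) = d x y)

/-- A set is closed with respect to the metric `d`. -/
def IsDClosed {G : Type*} (d : G → G → ℝ) (S : Set G) : Prop :=
  ∀ x : G, (∀ ε : ℝ, 0 < ε → ∃ s ∈ S, d x s < ε) → x ∈ S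

/-- A metric on the amalgamated free product extends the amalgam metric: it restricts to `d λ`
on each factor and realizes the amalgam distance between elements of distinct factors. -/
def ExtendsAmalgamMetric {Λ : Type*} {G : Λ → Type*} [∀ l, Group (G l)]
    {A : Type*} [Group A] (φ : ∀ l, A →* G l) (d : ∀ l, G l → G l → ℝ)
    (dbar : Monoid.PushoutI φ → Monoid.PushoutI φ → ℝ) : Prop :=
  (∀ (l : Λ) (g h : G l),
    dbar (Monoid.PushoutI.of (φ := φ) l g) (Monoid.PushoutI.of (φ := φ) l h) = d l g h) ∧
  (∀ (l₁ l₂ : Λ), l₁ ≠ l₂ → ∀ (g₁ : G l₁) (g₂ : G l₂),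
    dbar (Monoid.PushoutI.of (φ := φ) l₁ g₁) (Monoid.PushoutI.of (φ := φ) l₂ g₂)
      = ⨅ a : A, (d l₁ g₁ (φ l₁ a) + d l₂ (φ l₂ a) g₂))

/-- The underlying pointed set of the amalgam: the union `X = ⋃ λ of λ (G λ)` of the images of
the factors, with the identity removed; it serves as the basis of a free group. -/
def AmalgamBasis {Λ : Type*} {G : Λ → Type*} [∀ l, Group (G l)]
    {A : Type*} [Group A] (φ : ∀ l, A →* G l) : Type _ :=
  {x : Monoid.PushoutI φ // (∃ l, x ∈ Set.range ⇑(Monoid.PushoutI.of (φ := φ) l)) ∧ x ≠ 1}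

/-- The distance between the fibres of `π` over two points, for a two-sided invariant metric. -/
noncomputable def fiberDist {F P : Type*} [Group F] [Group P] (π : F →* P) (d : F → F → ℝ)
    (x y : P) : ℝ :=
  ⨅ u : {u : F // π u = x * y⁻¹}, d u.val 1

namespace IsTSIMetric

variable {F P : Type*} [Group F] [Group P]

theorem nonneg {d : F → F → ℝ} (hd : IsTSIMetric d) (x y : F) : 0 ≤ d x y := by
  obtain ⟨h0, hs, ht, -, -⟩ := hd
  have h1 := ht x y x
  rw [(h0 x x).2 rfl, hs y x] at h1
  linarith

theorem inv_inv {d : F → F → ℝ} (hd : IsTSIMetric d) (x y : F) : d x⁻¹ y⁻¹ = d x y := by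
  obtain ⟨-, hs, -, hl, hr⟩ := hd
  rw [← hl x, ← hr y (x * x⁻¹)]
  simp [hs y x]

theorem apply_mul_inv_one {d : F → F → ℝ} (hd : IsTSIMetric d) (x y : F) :
    d (x * y⁻¹) 1 = d x y := by
  rw [← hd.2.2.2.2 y]
  simp

theorem max_comap {d : F → F → ℝ} {e : P → P → ℝ} (hd : IsTSIMetric d) (he : IsTSIMetric e)
    (π : F →* P) : IsTSIMetric fun u v => max (d u v) (e (π u) (π v)) := by
  refine ⟨fun x y => ⟨fun h => ?_, ?_⟩, fun x y => ?_, fun x y z => ?_, fun g x y => ?_,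
    fun g x y => ?_⟩
  · exact (hd.1 x y).1 (le_antisymm (h ▸ le_max_left _ _) (hd.nonneg x y))
  · rintro rfl
    simp [(hd.1 x x).2 rfl, (he.1 (π x) (π x)).2 rfl]
  · simp only [hd.2.1 x y, he.2.1 (π x) (π y)]
  · exact max_le
      ((hd.2.2.1 x y z).trans (add_le_add (le_max_left _ _) (le_max_left _ _)))
      ((he.2.2.1 _ (π y) _).trans (add_le_add (le_max_right _ _) (le_max_right _ _)))
  · simp only [map_mul, hd.2.2.2.1, he.2.2.2.1]
  · simp only [map_mul, hd.2.2.2.2, he.2.2.2.2]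

theorem fiberDist_le {d : F → F → ℝ} (hd : IsTSIMetric d) (π : F →* P) {x y : P} {u : F}
    (hu : π u = x * y⁻¹) : fiberDist π d x y ≤ d u 1 :=
  ciInf_le (f := fun v : {v : F // π v = x * y⁻¹} => d v.val 1)
    ⟨0, by rintro _ ⟨v, rfl⟩; exact hd.nonneg _ _⟩ ⟨u, hu⟩

theorem le_fiberDist {d : F → F → ℝ} {π : F →* P} (hπ : Function.Surjective π) {x y : P} {c : ℝ}
    (h : ∀ u, π u = x * y⁻¹ → c ≤ d u 1) : c ≤ fiberDist π d x y := by
  obtain ⟨u, hu⟩ := hπ (x * y⁻¹)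
  have : Nonempty {u : F // π u = x * y⁻¹} := ⟨⟨u, hu⟩⟩
  exact le_ciInf fun v => h v.val v.property

/-- A fibre distance dominating a two-sided invariant metric is itself such a metric. -/
theorem isTSIMetric_fiberDist {d : F → F → ℝ} {e : P → P → ℝ} (hd : IsTSIMetric d)
    (he : IsTSIMetric e) {π : F →* P} (hπ : Function.Surjective π)
    (hle : ∀ x y, e x y ≤ fiberDist π d x y) : IsTSIMetric (fiberDist π d) := by
  have hsymm : ∀ x y, fiberDist π d x y ≤ fiberDist π d y x := fun x y =>
    le_fiberDist hπ fun u hu => by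
      rw [← hd.inv_inv, inv_one]
      exact hd.fiberDist_le π (by simp [hu])
  have hleft : ∀ g x y, fiberDist π d (g * x) (g * y) ≤ fiberDist π d x y := fun g x y =>
    le_fiberDist hπ fun u hu => by
      obtain ⟨w, rfl⟩ := hπ g
      refine (hd.fiberDist_le π (u := w * u * w⁻¹) (by simp [hu, mul_assoc])).trans_eq ?_
      rw [hd.apply_mul_inv_one, ← hd.2.2.2.1 w u 1, mul_one]
  refine ⟨fun x y => ⟨fun h => ?_, ?_⟩, fun x y => (hsymm x y).antisymm (hsymm y x),
    fun x y z => ?_, fun g x y => (hleft g x y).antisymm ?_, fun g x y => ?_⟩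
  · exact (he.1 x y).1 (le_antisymm (h ▸ hle x y) (he.nonneg x y))
  · rintro rfl
    refine le_antisymm ?_ (le_fiberDist hπ fun u _ => hd.nonneg u 1)
    exact (hd.fiberDist_le π (u := 1) (by simp)).trans_eq ((hd.1 1 1).2 rfl)
  · rw [← sub_le_iff_le_add]
    refine le_fiberDist hπ fun u hu => ?_
    rw [sub_le_comm]
    refine le_fiberDist hπ fun v hv => ?_
    have h1 := hd.fiberDist_le π (x := x) (y := z) (u := u * v) (by simp [hu, hv, mul_assoc])
    have h2 := hd.2.2.1 (u * v) v 1
    have h3 := hd.2.2.2.2 v u 1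
    rw [one_mul] at h3
    linarith
  · simpa using hleft g⁻¹ (g * x) (g * y)
  · have h : x * g * (y * g)⁻¹ = x * y⁻¹ := by group
    rw [fiberDist, fiberDist, h]

end IsTSIMetric

/-- Metrics agreeing on the union of the factors extend the amalgam metric simultaneously. -/
theorem ExtendsAmalgamMetric.congr {Λ : Type*} {G : Λ → Type*} [∀ l, Group (G l)]
    {A : Type*} [Group A] {φ : ∀ l, A →* G l} {d : ∀ l, G l → G l → ℝ}
    {e e' : Monoid.PushoutI φ → Monoid.PushoutI φ → ℝ} (h : ExtendsAmalgamMetric φ d e)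
    (hee' : ∀ l₁ l₂ (g₁ : G l₁) (g₂ : G l₂),
      e' (Monoid.PushoutI.of l₁ g₁) (Monoid.PushoutI.of l₂ g₂)
        = e (Monoid.PushoutI.of l₁ g₁) (Monoid.PushoutI.of l₂ g₂)) :
    ExtendsAmalgamMetric φ d e' :=
  ⟨fun l g k => (hee' l l g k).trans (h.1 l g k),
    fun l₁ l₂ hl g₁ g₂ => (hee' l₁ l₂ g₁ g₂).trans (h.2 l₁ l₂ hl g₁ g₂)⟩

section

variable {Λ : Type*} {G : Λ → Type*} [∀ l, Group (G l)] {A : Type*} [Group A] {φ : ∀ l, A →* G l}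

theorem exists_eq_one_or_of_eq_of {π : FreeGroup (AmalgamBasis φ) →* Monoid.PushoutI φ}
    (hπ : ∀ b : AmalgamBasis φ, π (FreeGroup.of b) = (b.val : Monoid.PushoutI φ))
    (l : Λ) (g : G l) :
    ∃ u, π u = Monoid.PushoutI.of l g ∧ (u = 1 ∨ ∃ b, u = FreeGroup.of b) := by
  by_cases h : (Monoid.PushoutI.of l g : Monoid.PushoutI φ) = 1
  · exact ⟨1, by simp [h], Or.inl rfl⟩
  · exact ⟨FreeGroup.of ⟨_, ⟨l, g, rfl⟩, h⟩, hπ _, Or.inr ⟨_, rfl⟩⟩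

theorem surjective_of_apply_of_eq_val [Nonempty Λ]
    {π : FreeGroup (AmalgamBasis φ) →* Monoid.PushoutI φ}
    (hπ : ∀ b : AmalgamBasis φ, π (FreeGroup.of b) = (b.val : Monoid.PushoutI φ)) :
    Function.Surjective π := by
  have hof : ∀ (l : Λ) (g : G l), ∃ u, π u = Monoid.PushoutI.of l g := fun l g =>
    (exists_eq_one_or_of_eq_of hπ l g).imp fun _ h => h.1
  intro p
  induction p using Monoid.PushoutI.induction_on with
  | of l g => exact hof l g
  | base a =>
    obtain ⟨l⟩ := ‹Nonempty Λ›
    rw [← Monoid.PushoutI.of_apply_eq_base φ l]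
    exact hof l _
  | mul x y hx hy =>
    obtain ⟨u, rfl⟩ := hx
    obtain ⟨v, rfl⟩ := hy
    exact ⟨u * v, map_mul π u v⟩

end

/-- The amalgam with the Graev metric is isometrically isomorphic to the quotient of the free
group over the union of the factors, equipped with the Graev free-group metric `d_F`, by the
kernel `N` of the canonical surjection `π`: for every `f`,
`d̄(π f, 1) = inf { d_F(f h, 1) : h ∈ N }`. -/
theorem graev_metric_as_quotient {Λ : Type*} [Nonempty Λ] {G : Λ → Type*} [∀ l, Group (G l)]
    (d : ∀ l, G l → G l → ℝ) (hd : ∀ l, IsTSIMetric (d l))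
    {A : Type*} [Group A] (φ : ∀ l, A →* G l)
    (hinj : ∀ l, Function.Injective (φ l))
    (hclosed : ∀ l, IsDClosed (d l) (Set.range (φ l)))
    (hagree : ∀ (l₁ l₂ : Λ) (a a' : A), d l₁ (φ l₁ a) (φ l₁ a') = d l₂ (φ l₂ a) (φ l₂ a'))
    (dbar : Monoid.PushoutI φ → Monoid.PushoutI φ → ℝ)
    (hdbar : IsTSIMetric dbar) (hext : ExtendsAmalgamMetric φ d dbar)
    (hmax : ∀ δ : Monoid.PushoutI φ → Monoid.PushoutI φ → ℝ,
      IsTSIMetric δ → ExtendsAmalgamMetric φ d δ →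
      ∀ x y : Monoid.PushoutI φ, δ x y ≤ dbar x y)
    (π : FreeGroup (AmalgamBasis φ) →* Monoid.PushoutI φ)
    (hπ : ∀ b : AmalgamBasis φ, π (FreeGroup.of b) = (b.val : Monoid.PushoutI φ))
    (dF : FreeGroup (AmalgamBasis φ) → FreeGroup (AmalgamBasis φ) → ℝ)
    (hdF : IsTSIMetric dF)
    (hgen : ∀ x y : AmalgamBasis φ, dF (FreeGroup.of x) (FreeGroup.of y) = dbar x.val y.val)
    (hgeninv : ∀ x y : AmalgamBasis φ,
      dF (FreeGroup.of x)⁻¹ (FreeGroup.of y)⁻¹ = dbar x.val y.val)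
    (hgenmix : ∀ x y : AmalgamBasis φ,
      dF (FreeGroup.of x) (FreeGroup.of y)⁻¹ = dbar x.val 1 + dbar 1 y.val)
    (hgenone : ∀ x : AmalgamBasis φ, dF (FreeGroup.of x) 1 = dbar x.val 1)
    (hFmax : ∀ δ : FreeGroup (AmalgamBasis φ) → FreeGroup (AmalgamBasis φ) → ℝ,
      IsTSIMetric δ →
      (∀ x y : AmalgamBasis φ, δ (FreeGroup.of x) (FreeGroup.of y) = dbar x.val y.val) →
      (∀ x y : AmalgamBasis φ, δ (FreeGroup.of x)⁻¹ (FreeGroup.of y)⁻¹ = dbar x.val y.val) →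
      (∀ x y : AmalgamBasis φ,
        δ (FreeGroup.of x) (FreeGroup.of y)⁻¹ = dbar x.val 1 + dbar 1 y.val) →
      (∀ x : AmalgamBasis φ, δ (FreeGroup.of x) 1 = dbar x.val 1) →
      ∀ u v, δ u v ≤ dF u v) :
    ∀ f : FreeGroup (AmalgamBasis φ), dbar (π f) 1 = ⨅ h : π.ker, dF (f * ↑h) 1 := by
  have hsurj := surjective_of_apply_of_eq_val hπ
  have hlip : ∀ u v, dbar (π u) (π v) ≤ dF u v := by
    intro u v
    refine (le_max_right _ _).trans
      (hFmax _ (hdF.max_comap hdbar π) (fun x y => ?_) (fun x y => ?_) (fun x y => ?_)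
        (fun x => ?_) u v)
    · simp [hπ, hgen]
    · simp [hπ, hgeninv, hdbar.inv_inv]
    · rw [hgenmix, map_inv, hπ, hπ, max_eq_left]
      refine (hdbar.2.2.1 _ 1 _).trans_eq ?_
      rw [← hdbar.inv_inv 1 y.val, inv_one]
    · simp [hπ, hgenone]
  have hle : ∀ x y, dbar x y ≤ fiberDist π dF x y := fun x y =>
    IsTSIMetric.le_fiberDist hsurj fun u hu => by
      have h := hlip u 1
      rwa [hu, map_one, hdbar.apply_mul_inv_one] at h
  have hX : ∀ u v : FreeGroup (AmalgamBasis φ), (u = 1 ∨ ∃ b, u = FreeGroup.of b) →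
      (v = 1 ∨ ∃ b, v = FreeGroup.of b) → dF u v = dbar (π u) (π v) := by
    rintro u v (rfl | ⟨b, rfl⟩) (rfl | ⟨c, rfl⟩)
    · rw [(hdF.1 1 1).2 rfl, (hdbar.1 _ _).2 rfl]
    · rw [hdF.2.1, hgenone, map_one, hπ, hdbar.2.1]
    · rw [hgenone, map_one, hπ]
    · rw [hgen, hπ, hπ]
  have hge : ∀ x y, fiberDist π dF x y ≤ dbar x y := by
    refine hmax _ (hdF.isTSIMetric_fiberDist hdbar hsurj hle)
      (hext.congr fun l₁ l₂ g₁ g₂ => le_antisymm ?_ (hle _ _))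
    obtain ⟨u, hu, hu'⟩ := exists_eq_one_or_of_eq_of hπ l₁ g₁
    obtain ⟨v, hv, hv'⟩ := exists_eq_one_or_of_eq_of hπ l₂ g₂
    rw [← hu, ← hv, ← hX u v hu' hv', ← hdF.apply_mul_inv_one]
    exact hdF.fiberDist_le π (by simp)
  intro f
  refine le_antisymm (le_ciInf fun h => ?_) (le_trans ?_ (hge _ _))
  · have h1 := hlip (f * ↑h) 1
    rwa [map_mul, map_one, (π.mem_ker).1 h.2, mul_one] at h1
  · refine IsTSIMetric.le_fiberDist hsurj fun u hu => ?_
    have hbdd : BddBelow (Set.range fun h : π.ker => dF (f * ↑h) 1) :=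
      ⟨0, by rintro _ ⟨h, rfl⟩; exact hdF.nonneg _ _⟩
    simpa using ciInf_le hbdd ⟨f⁻¹ * u, π.mem_ker.2 (by simp [hu])⟩
end

section
/- Let Λ be an index set, {G_λ}_{λ∈Λ} a family of groups, and A a group with injective homomorphisms φ_λ : A → G_λ; let ∐_A G_λ be the amalgamated free product (pushout) with canonical injective homomorphisms of_λ : G_λ → ∐_A G_λ. Let w = ((λ₁, g₁), …, (λ_n, g_n)) be a word (g_i ∈ G_{λ_i}), and let i₁ < i₂ < … < i_m be exactly those indices with g_{i_k} ∉ φ_{λ_{i_k}}(A) (the external letters). If m ≥ 1 and λ_{i_k} ≠ λ_{i_{k+1}} for all k ∈ {1, …, m−1} (the word is alternating), then of_{λ₁}(g₁) · of_{λ₂}(g₂) ⋯ of_{λ_n}(g_n) ≠ 1 in ∐_A G_λ. -/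
/-- If any two elements satisfying `p` with no element satisfying `p` between them are related
by `R`, then the sublist of elements satisfying `p` is an `R`-chain. -/
theorem List.isChain_filter_of_forall_eq_append {α : Type*} {R : α → α → Prop} {p : α → Bool} :
    ∀ {L : List α}, (∀ l₁ x l₂ y l₃, L = l₁ ++ x :: (l₂ ++ y :: l₃) → p x → p y →
      (∀ z ∈ l₂, ¬ p z) → R x y) → (L.filter p).IsChain R
  | [], _ => by simp
  | a :: t, h => by
    have ht : (t.filter p).IsChain R :=
      List.isChain_filter_of_forall_eq_append fun l₁ x l₂ y l₃ e =>
        h (a :: l₁) x l₂ y l₃ (by simp [e])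
    by_cases ha : p a
    · rw [List.filter_cons_of_pos ha, List.isChain_cons]
      refine ⟨fun y hy => ?_, ht⟩
      rw [List.head?_filter, Option.mem_def, List.find?_eq_some_iff_append] at hy
      obtain ⟨hpy, l₂, l₃, rfl, hl₂⟩ := hy
      exact h [] a l₂ y l₃ rfl ha hpy (by simpa using hl₂)
    · rwa [List.filter_cons_of_neg ha]

namespace Monoid.PushoutI

variable {Λ : Type*} {G : Λ → Type*} [∀ l, Group (G l)] {A : Type*} [Group A]

open Classical in
/-- Letters in the amalgamated subgroup can be pushed to the left of a word, leaving the factors of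
the external letters unchanged. -/
theorem exists_base_mul_prod_eq (φ : ∀ l, A →* G l) (L : List (Σ l, G l)) :
    ∃ (b : A) (L' : List (Σ l, G l)),
      (∀ x ∈ L', x.2 ∉ (φ x.1).range) ∧
      L'.map Sigma.fst = (L.filter fun x => x.2 ∉ (φ x.1).range).map Sigma.fst ∧
      (L.map fun x => of (φ := φ) x.1 x.2).prod =
        base φ b * (L'.map fun x => of (φ := φ) x.1 x.2).prod := by
  induction L with
  | nil => exact ⟨1, [], by simp⟩
  | cons x L ih =>
    obtain ⟨b, L', hL', hmap, hprod⟩ := ih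
    by_cases hx : x.2 ∈ (φ x.1).range
    · obtain ⟨c, hc⟩ := id hx
      refine ⟨c * b, L', hL', ?_, ?_⟩
      · rw [hmap, List.filter_cons_of_neg (by simpa using hx)]
      · rw [List.map_cons, List.prod_cons, hprod, ← hc, of_apply_eq_base, map_mul, mul_assoc]
    · refine ⟨1, ⟨x.1, x.2 * φ x.1 b⟩ :: L', ?_, ?_, ?_⟩
      · rintro y (_ | ⟨_, hy⟩)
        · exact fun h => hx ((Subgroup.mul_mem_cancel_right _ (MonoidHom.mem_range.2 ⟨b, rfl⟩)).1 h)
        · exact hL' y hy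
      · rw [List.filter_cons_of_pos (by simpa using hx), List.map_cons, List.map_cons, hmap]
      · simp [hprod, of_apply_eq_base, mul_assoc]

end Monoid.PushoutI

/-- **Alternating words in amalgams are nontrivial.**  If a word over the factors of an
amalgamated free product has at least one letter outside the amalgamated subgroup and any two
consecutive external letters (i.e. external letters with only non-external letters between them)
lie in distinct factors, then the word does not evaluate to the identity. -/
theorem alternating_word_ne_one {Λ : Type*} {G : Λ → Type*} [∀ l, Group (G l)]
    {A : Type*} [Group A] (φ : ∀ l, A →* G l)
    (hinj : ∀ l, Function.Injective (φ l))
    (n : ℕ) (lam : Fin n → Λ) (g : ∀ i : Fin n, G (lam i))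
    (hext : ∃ i : Fin n, g i ∉ Set.range (φ (lam i)))
    (halt : ∀ i j : Fin n, i < j →
      g i ∉ Set.range (φ (lam i)) → g j ∉ Set.range (φ (lam j)) →
      (∀ k : Fin n, i < k → k < j → g k ∈ Set.range (φ (lam k))) →
      lam i ≠ lam j) :
    (List.ofFn (fun i : Fin n => Monoid.PushoutI.of (φ := φ) (lam i) (g i))).prod ≠ 1 := by
  classical
  let f : Fin n → Σ l, G l := fun i => ⟨lam i, g i⟩
  obtain ⟨b, L', hL', hmap, hprod⟩ := Monoid.PushoutI.exists_base_mul_prod_eq φ (List.ofFn f)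
  have hchain : ((List.ofFn f).filter fun x => x.2 ∉ (φ x.1).range).IsChain
      (fun x y => x.1 ≠ y.1) := by
    refine List.isChain_filter_of_forall_eq_append fun l₁ x l₂ y l₃ e hx hy hl₂ => ?_
    have hlen : n = l₁.length + (l₂.length + (l₃.length + 1) + 1) := by
      simpa using congrArg List.length e
    have hget (k : ℕ) (hk : k < n) : (l₁ ++ x :: (l₂ ++ y :: l₃))[k]? = some (f ⟨k, hk⟩) := by
      rw [← e]
      simp [hk]
    have hi := hget l₁.length (by omega)
    have hj := hget (l₁.length + (l₂.length + 1)) (by omega)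
    simp only [List.getElem?_append_right, le_refl, Nat.sub_self, List.getElem?_cons_zero,
      Option.some.injEq] at hi
    simp only [List.getElem?_append_right, Nat.le_add_right, Nat.add_sub_cancel_left,
      List.getElem?_cons_succ, le_refl, Nat.sub_self, List.getElem?_cons_zero,
      Option.some.injEq] at hj
    subst hi hj
    refine halt _ _ (by simp) (by simpa using hx) (by simpa using hy) fun k hik hkj => ?_
    obtain ⟨d, hd⟩ := Nat.exists_eq_add_of_lt (Fin.lt_def.1 hik)
    have hdl : d < l₂.length := by
      have := Fin.lt_def.1 hkj
      simp only at this hd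
      omega
    have hk : l₂[d]? = some (f k) := by
      refine Eq.trans ?_ (hget k k.2)
      rw [show (k : ℕ) = l₁.length + (d + 1) from hd, List.getElem?_append_right (by omega),
        Nat.add_sub_cancel_left, List.getElem?_cons_succ, List.getElem?_append_left hdl]
    simpa [f] using hl₂ _ (List.mem_of_getElem? hk)
  let w : Monoid.CoprodI.Word G :=
    { toList := L'
      ne_one := fun x hx h => hL' x hx (h ▸ one_mem _)
      chain_ne := by
        rw [← List.isChain_map (R := (· ≠ ·)) Sigma.fst] at hchain ⊢
        rwa [hmap] }
  intro h
  have hw : Monoid.PushoutI.ofCoprodI w.prod =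
      (L'.map fun x => Monoid.PushoutI.of (φ := φ) x.1 x.2).prod := by
    simp [w, Monoid.CoprodI.Word.prod, map_list_prod, Function.comp_def]
  have hone : Monoid.PushoutI.base φ b * Monoid.PushoutI.ofCoprodI w.prod = 1 := by
    rw [hw, ← hprod, List.map_ofFn]
    exact h
  have hempty : w = .empty := Monoid.PushoutI.Reduced.eq_empty_of_mem_range hinj hL'
    ⟨b⁻¹, by rw [map_inv, inv_eq_of_mul_eq_one_right hone]⟩
  have hnil : L' = [] := congrArg Monoid.CoprodI.Word.toList hempty
  obtain ⟨i, hi⟩ := hext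
  rw [hnil, List.map_nil, eq_comm, List.map_eq_nil_iff, List.filter_eq_nil_iff] at hmap
  exact hmap (f i) (List.mem_ofFn.2 ⟨i, rfl⟩) (by simpa [f] using hi)
end

section
/- Let Λ be an index set, {G_λ}_{λ∈Λ} a family of groups, and A a group with injective homomorphisms φ_λ : A → G_λ; let ∐_A G_λ be the amalgamated free product with canonical injective homomorphisms of_λ : G_λ → ∐_A G_λ. Let w = ((λ₁, g₁), …, (λ_n, g_n)) be a word whose evaluation of_{λ₁}(g₁) ⋯ of_{λ_n}(g_n) equals 1 and which has at least one letter outside of A. Then there exist indices 1 ≤ p ≤ q ≤ n such that: (i) of_{λ_p}(g_p) · of_{λ_{p+1}}(g_{p+1}) ⋯ of_{λ_q}(g_q) lies in the image of A (i.e. equals of_μ(φ_μ(a)) for some a ∈ A and any μ); (ii) any two letters with indices in [p, q] are multipliable, i.e. for all i, j ∈ [p, q] either λ_i = λ_j or g_i ∈ φ_{λ_i}(A) or g_j ∈ φ_{λ_j}(A); and (iii) g_p ∉ φ_{λ_p}(A) and g_q ∉ φ_{λ_q}(A). -/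
section Amalgam

open Monoid Monoid.PushoutI

variable {Λ : Type*} {G : Λ → Type*} [∀ l, Group (G l)] {A : Type*} [Group A] {φ : ∀ l, A →* G l}
  {ι : Type*} {lam : ι → Λ} {g : ∀ i, G (lam i)}

/-- The value in the amalgam of the list of indices `v` of letters `(lam i, g i)`. -/
def wordEval (φ : ∀ l, A →* G l) {lam : ι → Λ} (g : ∀ i, G (lam i)) (v : List ι) : PushoutI φ :=
  (v.map fun i => of (φ := φ) (lam i) (g i)).prod

/-- The letters of `v` outside of the amalgamated subgroup all lie in the factor `μ`, and the
first and the last letter of `v` are among them. -/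
def IsBlock (φ : ∀ l, A →* G l) {lam : ι → Λ} (g : ∀ i, G (lam i)) (μ : Λ) (v : List ι) : Prop :=
  (∃ p l, v = p :: l ∧ g p ∉ Set.range (φ (lam p))) ∧
  (∃ l q, v = l ++ [q] ∧ g q ∉ Set.range (φ (lam q))) ∧
  ∀ i ∈ v, lam i = μ ∨ g i ∈ Set.range (φ (lam i))

theorem wordEval_append (u v : List ι) :
    wordEval φ g (u ++ v) = wordEval φ g u * wordEval φ g v := by
  simp [wordEval]

theorem wordEval_mem_range_base {v : List ι} (h : ∀ i ∈ v, g i ∈ Set.range (φ (lam i))) :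
    wordEval φ g v ∈ (base φ).range := by
  refine Subgroup.list_prod_mem _ fun x hx => ?_
  obtain ⟨i, hi, rfl⟩ := List.mem_map.1 hx
  obtain ⟨a, ha⟩ := h i hi
  exact ⟨a, by rw [← ha, of_apply_eq_base]⟩

theorem wordEval_mem_range_of {v : List ι} {μ : Λ}
    (h : ∀ i ∈ v, lam i = μ ∨ g i ∈ Set.range (φ (lam i))) :
    wordEval φ g v ∈ (of (φ := φ) μ).range := by
  refine Subgroup.list_prod_mem _ fun x hx => ?_
  obtain ⟨i, hi, rfl⟩ := List.mem_map.1 hx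
  rcases h i hi with rfl | ⟨a, ha⟩
  · exact ⟨_, rfl⟩
  · exact ⟨φ μ a, by rw [← ha, of_apply_eq_base, of_apply_eq_base]⟩

/-- Absorbing a block with value outside of the amalgamated subgroup, together with
neighbouring elements of the amalgamated subgroup, into a reduced word. -/
theorem exists_reduced_cons {s v : List ι} {μ : Λ}
    (hs : ∀ i ∈ s, g i ∈ Set.range (φ (lam i))) (hv : IsBlock φ g μ v)
    (hnb : wordEval φ g v ∉ (base φ).range) (a : A) {w : CoprodI.Word G} (hw : Reduced φ w)
    (hμ : w.fstIdx ≠ some μ) :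
    ∃ w' : CoprodI.Word G, Reduced φ w' ∧ w'.fstIdx = some μ ∧
      ofCoprodI w'.prod = wordEval φ g s * wordEval φ g v * (base φ a * ofCoprodI w.prod) := by
  obtain ⟨b, hb⟩ := wordEval_mem_range_base hs
  obtain ⟨h, hh⟩ := wordEval_mem_range_of hv.2.2
  have hnot : φ μ b * h * φ μ a ∉ (φ μ).range := by
    rintro ⟨c, hc⟩
    refine hnb ⟨b⁻¹ * c * a⁻¹, ?_⟩
    rw [← hh, ← of_apply_eq_base φ μ]
    congr 1
    rw [map_mul, map_mul, hc]
    simp [mul_assoc]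
  refine ⟨CoprodI.Word.cons (φ μ b * h * φ μ a) w hμ
    (fun h1 => hnot (h1 ▸ one_mem _)), ?_, CoprodI.Word.fstIdx_cons .., ?_⟩
  · intro x hx
    rcases List.mem_cons.1 hx with rfl | hx
    · exact hnot
    · exact hw x hx
  · rw [CoprodI.Word.prod_cons, map_mul, ofCoprodI_of, map_mul, map_mul, hh, of_apply_eq_base,
      of_apply_eq_base, hb]
    simp only [mul_assoc]

/-- If no block of `L` evaluates into the amalgamated subgroup, then `L` splits into letters of
the amalgamated subgroup, a block, and a tail with an explicit reduced form. -/
theorem exists_block_decomposition (L : List ι)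
    (hL : ∀ v μ, v <:+: L → IsBlock φ g μ v → wordEval φ g v ∉ (base φ).range) :
    (∀ i ∈ L, g i ∈ Set.range (φ (lam i))) ∨
    ∃ s v t μ, L = s ++ v ++ t ∧ (∀ i ∈ s, g i ∈ Set.range (φ (lam i))) ∧ IsBlock φ g μ v ∧
      ∃ (a : A) (w : CoprodI.Word G), Reduced φ w ∧ w.fstIdx ≠ some μ ∧
        wordEval φ g t = base φ a * ofCoprodI w.prod := by
  induction L with
  | nil => simp
  | cons k L ih =>
    have hsingle (hk : g k ∉ Set.range (φ (lam k))) : IsBlock φ g (lam k) [k] :=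
      ⟨⟨k, [], rfl, hk⟩, ⟨[], k, rfl, hk⟩, by simp⟩
    rcases ih fun v μ hv => hL v μ (hv.trans (List.suffix_cons k L).isInfix) with
      hA | ⟨s, v, t, μ, rfl, hs, hv, a, w, hw, hμ, ht⟩
    · by_cases hk : g k ∈ Set.range (φ (lam k))
      · left
        exact List.forall_mem_cons.2 ⟨hk, hA⟩
      · right
        obtain ⟨a, ha⟩ := wordEval_mem_range_base hA
        exact ⟨[], [k], L, lam k, rfl, by simp, hsingle hk, a, .empty,
          by simp [Reduced, CoprodI.Word.empty], by simp [CoprodI.Word.fstIdx, CoprodI.Word.empty],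
          by simp [ha]⟩
    · right
      by_cases hk : g k ∈ Set.range (φ (lam k))
      · exact ⟨k :: s, v, t, μ, rfl, List.forall_mem_cons.2 ⟨hk, hs⟩, hv, a, w, hw, hμ, ht⟩
      by_cases hkμ : lam k = μ
      · refine ⟨[], k :: s ++ v, t, μ, by simp, by simp, ⟨⟨k, _, rfl, hk⟩, ?_, ?_⟩,
          a, w, hw, hμ, ht⟩
        · obtain ⟨l, q, rfl, hq⟩ := hv.2.1
          exact ⟨k :: s ++ l, q, by simp, hq⟩
        · intro i hi
          simp only [List.cons_append, List.mem_cons, List.mem_append] at hi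
          rcases hi with rfl | hi | hi
          · exact .inl hkμ
          · exact .inr (hs i hi)
          · exact hv.2.2 i hi
      · obtain ⟨w', hw', hidx, hprod⟩ := exists_reduced_cons hs hv
          (hL v μ ⟨k :: s, t, by simp⟩ hv) a hw hμ
        refine ⟨[], [k], s ++ v ++ t, lam k, rfl, by simp, hsingle hk, 1, w', hw', ?_, ?_⟩
        · rw [hidx]
          exact fun h => hkμ (Option.some.inj h).symm
        · rw [wordEval_append, wordEval_append, ht, hprod, map_one, one_mul]

/-- A word with a letter outside of the amalgamated subgroup and with value in that subgroup
contains a block with value in that subgroup. -/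
theorem exists_isBlock_infix (hinj : ∀ l, Function.Injective (φ l)) {L : List ι}
    (hL : wordEval φ g L ∈ (base φ).range) (hext : ∃ i ∈ L, g i ∉ Set.range (φ (lam i))) :
    ∃ v μ, v <:+: L ∧ IsBlock φ g μ v ∧ wordEval φ g v ∈ (base φ).range := by
  by_contra! hno
  rcases exists_block_decomposition L hno with hA | ⟨s, v, t, μ, rfl, hs, hv, a, w, hw, hμ, ht⟩
  · obtain ⟨i, hi, hi'⟩ := hext
    exact hi' (hA i hi)
  · obtain ⟨w', hw', hidx, hprod⟩ := exists_reduced_cons hs hv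
      (hno v μ ⟨s, t, rfl⟩ hv) a hw hμ
    rw [wordEval_append, wordEval_append, ht, ← hprod] at hL
    rw [hw'.eq_empty_of_mem_range hinj hL] at hidx
    simp [CoprodI.Word.fstIdx, CoprodI.Word.empty] at hidx

end Amalgam

/-- In a strictly increasing list, a contiguous sublist consists of the entries between its
first and its last entry. -/
theorem List.filter_between_of_pairwise_lt {α : Type*} [LinearOrder α] {u v w : List α} {p q : α}
    (h : (u ++ v ++ w).Pairwise (· < ·)) (hp : ∃ l, v = p :: l) (hq : ∃ l, v = l ++ [q]) :
    (u ++ v ++ w).filter (fun i => decide (p ≤ i ∧ i ≤ q)) = v := by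
  have hpv : p ∈ v := by obtain ⟨l, rfl⟩ := hp; simp
  have hqv : q ∈ v := by obtain ⟨l, rfl⟩ := hq; simp
  rw [List.pairwise_append, List.pairwise_append] at h
  obtain ⟨⟨-, hv, huv⟩, -, hw⟩ := h
  have hu0 : u.filter (fun i => decide (p ≤ i ∧ i ≤ q)) = [] := by
    refine List.filter_eq_nil_iff.2 fun i hi => ?_
    have := huv i hi p hpv
    grind
  have hw0 : w.filter (fun i => decide (p ≤ i ∧ i ≤ q)) = [] := by
    refine List.filter_eq_nil_iff.2 fun i hi => ?_
    have := hw q (List.mem_append_right _ hqv) i hi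
    grind
  have hv1 : v.filter (fun i => decide (p ≤ i ∧ i ≤ q)) = v := by
    refine List.filter_eq_self.2 fun i hi => decide_eq_true ⟨?_, ?_⟩
    · obtain ⟨l, rfl⟩ := hp
      rcases List.mem_cons.1 hi with rfl | hi
      · exact le_rfl
      · exact ((List.pairwise_cons.1 hv).1 i hi).le
    · obtain ⟨l, rfl⟩ := hq
      rcases List.mem_append.1 hi with hi | hi
      · exact ((List.pairwise_append.1 hv).2.2 i hi q (by simp)).le
      · exact (List.mem_singleton.1 hi).le
  rw [List.filter_append, List.filter_append, hu0, hv1, hw0, List.nil_append, List.append_nil]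

/-- **Trivial words in amalgams contain a multipliable subword evaluating into the amalgamated
subgroup.**  If a word over the factors evaluates to the identity and has a letter outside the
amalgamated subgroup `A`, then there is an interval `[p, q]` of indices such that the
corresponding subword evaluates into the image of `A`, any two of its letters are multipliable,
and its first and last letters are outside of `A`. -/
theorem trivial_word_subword {Λ : Type*} {G : Λ → Type*} [∀ l, Group (G l)]
    {A : Type*} [Group A] (φ : ∀ l, A →* G l)
    (hinj : ∀ l, Function.Injective (φ l))
    (n : ℕ) (lam : Fin n → Λ) (g : ∀ i : Fin n, G (lam i))
    (htriv : (List.ofFn (fun i : Fin n => Monoid.PushoutI.of (φ := φ) (lam i) (g i))).prod = 1)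
    (hext : ∃ i : Fin n, g i ∉ Set.range (φ (lam i))) :
    ∃ p q : Fin n, p ≤ q ∧
      (∃ a : A,
        (((List.finRange n).filter (fun i => decide (p ≤ i ∧ i ≤ q))).map
          (fun i => Monoid.PushoutI.of (φ := φ) (lam i) (g i))).prod
            = Monoid.PushoutI.base φ a) ∧
      (∀ i j : Fin n, p ≤ i → i ≤ q → p ≤ j → j ≤ q →
        (lam i = lam j ∨ g i ∈ Set.range (φ (lam i)) ∨ g j ∈ Set.range (φ (lam j)))) ∧
      g p ∉ Set.range (φ (lam p)) ∧ g q ∉ Set.range (φ (lam q)) := by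
  obtain ⟨v, μ, ⟨u, w, huvw⟩, ⟨⟨p, l, hp, hgp⟩, ⟨l', q, hq, hgq⟩, hμ⟩, a, ha⟩ :=
    exists_isBlock_infix (lam := lam) (g := g) hinj (L := List.finRange n)
      ⟨1, by rw [map_one, wordEval, ← List.ofFn_eq_map, htriv]⟩
      (hext.imp fun i hi => ⟨List.mem_finRange i, hi⟩)
  have hfilter : (List.finRange n).filter (fun i => decide (p ≤ i ∧ i ≤ q)) = v := by
    rw [← huvw]
    refine List.filter_between_of_pairwise_lt ?_ ⟨l, hp⟩ ⟨l', hq⟩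
    rw [huvw]
    exact List.pairwise_lt_finRange n
  have hmem (i : Fin n) : i ∈ v ↔ p ≤ i ∧ i ≤ q := by
    simp [← hfilter]
  refine ⟨p, q, ((hmem p).1 (by simp [hp])).2, ⟨a, by rw [hfilter]; exact ha.symm⟩, ?_, hgp, hgq⟩
  intro i j hpi hiq hpj hjq
  rcases hμ i ((hmem i).2 ⟨hpi, hiq⟩) with hi | hi
  · rcases hμ j ((hmem j).2 ⟨hpj, hjq⟩) with hj | hj
    · exact .inl (hi.trans hj.symm)
    · exact .inr (.inr hj)
  · exact .inr (.inl hi)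
end

section
/- Let (G, d) be a group with a two-sided invariant metric, let A and B be closed subgroups of G, and let φ : A ≃ B be a group isomorphism with d(φ(a), φ(a')) = d(a, a') for all a, a' ∈ A. Let H be the HNN extension of G along φ (the group generated by G and a stable letter t subject to t·a·t⁻¹ = φ(a) for all a ∈ A), with canonical injective homomorphism of : G → H. If K > 0 satisfies diam(A) = sup_{a, a' ∈ A} d(a, a') ≤ K, then there exists a two-sided invariant metric d̄ on H such that d̄(of(g), of(h)) = d(g, h) for all g, h ∈ G and d̄(t, 1) = K. -/
open Sum

theorem append_eq_append_cons {α : Type*} {u v p q : List α} {x : α}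
    (h : u ++ v = p ++ x :: q) :
    (∃ r, p = u ++ r ∧ v = r ++ x :: q) ∨ ∃ s, u = p ++ x :: s ∧ q = s ++ v := by
  rcases List.append_eq_append_iff.1 h with h | ⟨_ | ⟨y, s⟩, rfl, h⟩
  · exact .inl h
  · exact .inl ⟨[], by simp, by simpa using h⟩
  · obtain ⟨rfl, rfl⟩ : y = x ∧ s ++ v = q := by simpa using h
    exact .inr ⟨s, rfl, rfl⟩

namespace HNNNormData

/-- The word `t ^ ε₁ * g₁ * ⋯ * t ^ εₙ * gₙ`. -/
def word {G : Type*} (l : List (ℤˣ × G)) : List (G ⊕ ℤˣ) :=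
  l.flatMap fun p => [inr p.1, inl p.2]

theorem word_cons {G : Type*} (p : ℤˣ × G) (l : List (ℤˣ × G)) :
    word (p :: l) = inr p.1 :: inl p.2 :: word l :=
  rfl

theorem exists_of_word_eq_append {G : Type*} {l : List (ℤˣ × G)} {p q : List (G ⊕ ℤˣ)} {ε : ℤˣ}
    (h : word l = p ++ inr ε :: q) :
    ∃ l₁ y l₂, l = l₁ ++ (ε, y) :: l₂ ∧ p = word l₁ := by
  induction l generalizing p with
  | nil => simp [word] at h
  | cons z l ih =>
    rcases p with _ | ⟨_, _ | ⟨_, p⟩⟩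
    · simp only [word_cons, List.nil_append, List.cons.injEq, inr.injEq] at h
      exact ⟨[], z.2, l, by simp [← h.1], rfl⟩
    · simp [word_cons] at h
    · simp only [word_cons, List.cons_append, List.cons.injEq] at h
      obtain ⟨rfl, rfl, h⟩ := h
      obtain ⟨l₁, y, l₂, rfl, rfl⟩ := ih h
      exact ⟨z :: l₁, y, l₂, rfl, rfl⟩

end HNNNormData

/-- A conjugation-invariant norm on `G`, together with the graphs `rel ε` of the partial
isomorphisms implemented by conjugation by `t ^ ε`, and the norm `K` of the stable letter. -/
structure HNNNormData (G : Type*) [Group G] where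
  /-- the norm on the base group -/
  norm : G → ℝ
  norm_one : norm 1 = 0
  norm_inv (g : G) : norm g⁻¹ = norm g
  norm_mul_le (g h : G) : norm (g * h) ≤ norm g + norm h
  norm_conj (g h : G) : norm (h * g * h⁻¹) = norm g
  /-- the norm of the stable letter -/
  K : ℝ
  /-- the graph of conjugation by the stable letter and by its inverse -/
  rel : ℤˣ → Subgroup (G × G)
  rel_swap {ε : ℤˣ} {a b : G} : (a, b) ∈ rel ε → (b, a) ∈ rel (-ε)
  norm_eq {ε : ℤˣ} {a b : G} : (a, b) ∈ rel ε → norm b = norm a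
  norm_le {ε : ℤˣ} {a b : G} : (a, b) ∈ rel ε → norm a ≤ K

namespace HNNNormData

variable {G : Type*} [Group G] (D : HNNNormData G)

theorem norm_nonneg (g : G) : 0 ≤ D.norm g := by
  have h := D.norm_mul_le g g⁻¹
  rw [mul_inv_cancel, D.norm_one, D.norm_inv] at h
  linarith

theorem K_nonneg : 0 ≤ D.K :=
  D.norm_one.symm.le.trans (D.norm_le (one_mem (D.rel 1)))

theorem norm_mul_comm (g h : G) : D.norm (g * h) = D.norm (h * g) := by
  rw [← D.norm_conj (g * h) h]
  group

variable {D} in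
theorem rel_mul {ε : ℤˣ} {a b a' b' : G} (h : (a, b) ∈ D.rel ε) (h' : (a', b') ∈ D.rel ε) :
    (a * a', b * b') ∈ D.rel ε :=
  mul_mem h h'

variable {D} in
theorem rel_inv {ε : ℤˣ} {a b : G} (h : (a, b) ∈ D.rel ε) : (a⁻¹, b⁻¹) ∈ D.rel ε :=
  inv_mem h

variable {D} in
theorem rel_swap_neg {ε : ℤˣ} {a b : G} (h : (a, b) ∈ D.rel (-ε)) : (b, a) ∈ D.rel ε := by
  simpa using D.rel_swap h

/-- `D.Evaluates w g c` means that the word `w` in the letters `g : G` and `t ^ ε` can be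
evaluated to `g : G` at cost `c`: some of the letters `t ^ ε` are matched with an inverse letter
without crossings, the other ones are replaced at cost `K` by `b * a⁻¹`, where
`b = t ^ ε * a * t ^ (-ε)` (so that `b * t ^ ε * a⁻¹ = t ^ ε`), and elements of `G` may be
inserted at the cost of their norm. -/
inductive Evaluates : List (G ⊕ ℤˣ) → G → ℝ → Prop
  | nil {g : G} {c : ℝ} : D.norm g ≤ c → Evaluates [] g c
  | base {x g : G} {w : List (G ⊕ ℤˣ)} {c : ℝ} :
      Evaluates w g c → Evaluates (inl x :: w) (x * g) c
  | erase {ε : ℤˣ} {a b g : G} {w : List (G ⊕ ℤˣ)} {c : ℝ} : (a, b) ∈ D.rel ε →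
      Evaluates w g c → Evaluates (inr ε :: w) (b * a⁻¹ * g) (c + D.K)
  | pair {ε : ℤˣ} {a b g : G} {u v : List (G ⊕ ℤˣ)} {c c' : ℝ} : (a, b) ∈ D.rel ε →
      Evaluates u a c → Evaluates v g c' →
      Evaluates (inr ε :: (u ++ inr (-ε) :: v)) (b * g) (c + c')

namespace Evaluates

variable {D}
variable {u v w : List (G ⊕ ℤˣ)} {g h x a b : G} {c c' : ℝ} {ε : ℤˣ}

theorem mul_right (hw : D.Evaluates w g c) (hx : D.norm x ≤ c') :
    D.Evaluates w (g * x) (c + c') := by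
  induction hw with
  | nil h => exact .nil ((D.norm_mul_le _ _).trans (add_le_add h hx))
  | base _ ih => rw [mul_assoc]; exact .base ih
  | erase hab _ ih => rw [mul_assoc, add_right_comm]; exact .erase hab ih
  | pair hab hu _ _ ih => rw [mul_assoc, add_assoc]; exact .pair hab hu ih

theorem congr (hw : D.Evaluates w g c) (hg : g = h) (hc : c = c') : D.Evaluates w h c' :=
  hg ▸ hc ▸ hw

theorem congr_word (hw : D.Evaluates u g c) (huv : u = v) (hg : g = h) : D.Evaluates v h c :=
  huv ▸ hg ▸ hw

theorem of_dist (hw : D.Evaluates w g c) (hc : c + D.norm (g⁻¹ * h) ≤ c') :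
    D.Evaluates w h c' :=
  (hw.mul_right (le_sub_iff_add_le'.2 hc)).congr (by group) (by ring)

theorem nonneg (hw : D.Evaluates w g c) : 0 ≤ c := by
  induction hw with
  | nil h => exact (D.norm_nonneg _).trans h
  | base _ ih => exact ih
  | erase _ _ ih => exact add_nonneg ih D.K_nonneg
  | pair _ _ _ ih ih' => exact add_nonneg ih ih'

theorem exists_cost (w : List (G ⊕ ℤˣ)) (g : G) : ∃ c, D.Evaluates w g c := by
  induction w generalizing g with
  | nil => exact ⟨_, .nil le_rfl⟩
  | cons l w ih =>
    rcases l with x | ε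
    · obtain ⟨c, hc⟩ := ih (x⁻¹ * g)
      exact ⟨c, hc.base.congr (by group) rfl⟩
    · obtain ⟨c, hc⟩ := ih g
      exact ⟨c + D.K, (hc.erase (a := 1) (b := 1) (one_mem _)).congr (by simp) rfl⟩

theorem append (hu : D.Evaluates u g c) (hv : D.Evaluates v h c') :
    D.Evaluates (u ++ v) (g * h) (c + c') := by
  induction hu with
  | @nil g c hg =>
    refine hv.of_dist ?_
    have : D.norm (h⁻¹ * (g * h)) = D.norm g := by
      rw [← mul_assoc, D.norm_mul_comm]
      group
    linarith
  | base _ ih => rw [mul_assoc]; exact .base ih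
  | erase hab _ ih => rw [mul_assoc, add_right_comm]; exact .erase hab ih
  | pair hab hu _ _ ih =>
    rw [mul_assoc, add_assoc, List.cons_append, List.append_assoc]
    exact .pair hab hu ih

theorem norm_le_of_nil (hw : D.Evaluates [] g c) : D.norm g ≤ c := by
  cases hw
  assumption

theorem of_cons_inl (hw : D.Evaluates (inl x :: w) g c) : D.Evaluates w (x⁻¹ * g) c := by
  cases hw with
  | base h => exact h.congr (by group) rfl

theorem cons_inl (hw : D.Evaluates w (x⁻¹ * g) c) : D.Evaluates (inl x :: w) g c :=
  hw.base.congr (by group) rfl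

theorem of_cons_inr (hw : D.Evaluates (inr ε :: w) g c) :
    (∃ a b c', (a, b) ∈ D.rel ε ∧ D.Evaluates w (a * b⁻¹ * g) c' ∧ c = c' + D.K) ∨
    ∃ a b u v c₁ c₂, w = u ++ inr (-ε) :: v ∧ (a, b) ∈ D.rel ε ∧ D.Evaluates u a c₁ ∧
      D.Evaluates v (b⁻¹ * g) c₂ ∧ c = c₁ + c₂ := by
  cases hw with
  | erase hab h => exact .inl ⟨_, _, _, hab, h.congr (by group) rfl, rfl⟩
  | pair hab hu hv =>
    exact .inr ⟨_, _, _, _, _, _, rfl, hab, hu, hv.congr (by group) rfl, rfl⟩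

theorem of_snoc_inr (hu : D.Evaluates (u ++ [inr ε]) g c) :
    (∃ a b c', (a, b) ∈ D.rel ε ∧ D.Evaluates u (g * (a * b⁻¹)) c' ∧ c = c' + D.K) ∨
    ∃ a b u₁ u₂ c₁ c₂, u = u₁ ++ inr (-ε) :: u₂ ∧ (a, b) ∈ D.rel ε ∧
      D.Evaluates u₁ (g * a⁻¹) c₁ ∧ D.Evaluates u₂ b c₂ ∧ c = c₁ + c₂ := by
  induction hn : u.length using Nat.strong_induction_on generalizing u g c with
  | _ n ih =>
  subst hn
  rcases u with _ | ⟨x | η, u⟩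
  · rcases of_cons_inr hu with ⟨a, b, c', hab, h, rfl⟩ | ⟨a, b, p, q, c₁, c₂, hpq, -⟩
    · refine .inl ⟨a, b, c', hab, .nil ?_, rfl⟩
      rw [D.norm_mul_comm]
      exact h.norm_le_of_nil
    · simp at hpq
  · rcases ih u.length (by simp) hu.of_cons_inl rfl with
      ⟨a, b, c', hab, h, rfl⟩ | ⟨a, b, p, q, c₁, c₂, rfl, hab, hp, hq, rfl⟩
    · exact .inl ⟨a, b, c', hab, cons_inl (h.congr (by group) rfl), rfl⟩
    · exact .inr ⟨a, b, inl x :: p, q, c₁, c₂, rfl, hab,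
        cons_inl (hp.congr (by group) rfl), hq, rfl⟩
  · rcases of_cons_inr hu with
      ⟨a', b', c', hab', h, rfl⟩ | ⟨a', b', r, s, d₁, d₂, hrs, hab', hr, hs, rfl⟩
    · rcases ih u.length (by simp) h rfl with
        ⟨a, b, c'', hab, h', rfl⟩ | ⟨a, b, p, q, c₁, c₂, rfl, hab, hp, hq, rfl⟩
      · exact .inl ⟨a, b, c'' + D.K, hab, (h'.erase hab').congr (by group) rfl, rfl⟩
      · exact .inr ⟨a, b, inr η :: p, q, c₁ + D.K, c₂, rfl, hab,
          (hp.erase hab').congr (by group) rfl, hq, by ring⟩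
    · rcases List.eq_nil_or_concat s with rfl | ⟨s', l, rfl⟩
      · obtain ⟨rfl, hl⟩ := List.append_inj' hrs rfl
        obtain rfl : ε = -η := by simpa using hl
        refine .inr ⟨b', a', [], u, d₂, d₁, by simp, D.rel_swap hab', .nil ?_, hr, by ring⟩
        rw [D.norm_mul_comm]
        exact hs.norm_le_of_nil
      · rw [List.concat_eq_append, ← List.cons_append, ← List.append_assoc] at hrs
        obtain ⟨rfl, hl⟩ := List.append_inj' hrs rfl
        obtain rfl : l = inr ε := by simpa using hl.symm
        rw [List.concat_eq_append] at hs
        rcases ih s'.length (by simp; omega) hs rfl with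
          ⟨a, b, c', hab, h, rfl⟩ | ⟨a, b, p, q, c₁, c₂, rfl, hab, hp, hq, rfl⟩
        · exact .inl ⟨a, b, d₁ + c', hab, (hr.pair hab' h).congr (by group) rfl, by ring⟩
        · exact .inr ⟨a, b, inr η :: (r ++ inr (-η) :: p), q, d₁ + c₁, c₂, by simp, hab,
            (hr.pair hab' hp).congr (by group) rfl, hq, by ring⟩

theorem rotate (hu : D.Evaluates (u ++ [inr ε]) a c) (hab : (a, b) ∈ D.rel ε) :
    D.Evaluates (inr ε :: u) b c := by
  rcases of_snoc_inr hu with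
    ⟨a', b', c', hab', h, rfl⟩ | ⟨a', b', u₁, u₂, c₁, c₂, rfl, hab', h₁, h₂, rfl⟩
  · exact (h.erase (rel_mul hab hab')).congr (by group) rfl
  · exact (h₁.pair (rel_mul hab (rel_inv hab')) h₂).congr (by group) rfl

/-- Rewriting of a subword, reduced to the case where the subword is a prefix and to the case
where it contains a letter which is matched with an earlier letter. -/
theorem rewrite {w w' : List (G ⊕ ℤˣ)}
    (hprefix : ∀ v g c, D.Evaluates (w ++ v) g c → D.Evaluates (w' ++ v) g c)
    (hclose : ∀ w₁ w₂ η, w = w₁ ++ inr (-η) :: w₂ → ∀ u v a b g c₁ c₂, (a, b) ∈ D.rel η →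
      D.Evaluates (u ++ w₁) a c₁ → D.Evaluates (w₂ ++ v) g c₂ →
      D.Evaluates (inr η :: (u ++ (w' ++ v))) (b * g) (c₁ + c₂))
    (u v : List (G ⊕ ℤˣ)) (g : G) (c : ℝ) (hw : D.Evaluates (u ++ (w ++ v)) g c) :
    D.Evaluates (u ++ (w' ++ v)) g c := by
  induction hn : u.length using Nat.strong_induction_on generalizing u v g c with
  | _ n ih =>
  subst hn
  rcases u with _ | ⟨x | η, u⟩
  · exact hprefix _ _ _ hw
  · exact cons_inl (ih u.length (by simp) u _ _ _ hw.of_cons_inl rfl)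
  · rcases of_cons_inr hw with
      ⟨a, b, c', hab, h, rfl⟩ | ⟨a, b, p, q, c₁, c₂, hpq, hab, hp, hq, rfl⟩
    · exact ((ih u.length (by simp) u _ _ _ h rfl).erase hab).congr (by group) rfl
    · rcases append_eq_append_cons hpq with ⟨r, rfl, h⟩ | ⟨s, rfl, rfl⟩
      · rcases append_eq_append_cons h with ⟨r, rfl, rfl⟩ | ⟨s, rfl, rfl⟩
        · exact ((ih u.length (by simp) u _ _ _ hp rfl).pair hab hq).congr_word
            (by simp) (by group)
        · exact (hclose _ _ η rfl u v a b _ c₁ c₂ hab hp hq).congr (by group) rfl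
      · exact (hp.pair hab (ih s.length (by simp; omega) s _ _ _ hq rfl)).congr_word
          (by simp) (by group)

theorem rewrite_base {l l' : List G}
    (hprefix : ∀ v g c, D.Evaluates (l.map inl ++ v) g c → D.Evaluates (l'.map inl ++ v) g c)
    (u v : List (G ⊕ ℤˣ)) (g : G) (c : ℝ) (hw : D.Evaluates (u ++ (l.map inl ++ v)) g c) :
    D.Evaluates (u ++ (l'.map inl ++ v)) g c := by
  refine rewrite hprefix (fun w₁ w₂ η h => ?_) u v g c hw
  have : inr (-η) ∈ l.map (inl : G → G ⊕ ℤˣ) := by simp [h]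
  simp at this

theorem insert_inr (ε : ℤˣ) (u v : List (G ⊕ ℤˣ)) (g : G) (c : ℝ)
    (hw : D.Evaluates (u ++ v) g c) :
    D.Evaluates (u ++ ([inr ε, inr (-ε)] ++ v)) g c := by
  refine rewrite (w := []) (fun v g c h => ?_) (fun w₁ w₂ η h => by simp at h) u v g c hw
  exact (pair (u := []) (one_mem (D.rel ε)) (.nil D.norm_one.le) h).congr
    (one_mul g) (zero_add c)

theorem cancel_inr (ε : ℤˣ) (u v : List (G ⊕ ℤˣ)) (g : G) (c : ℝ)
    (hw : D.Evaluates (u ++ ([inr ε, inr (-ε)] ++ v)) g c) :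
    D.Evaluates (u ++ v) g c := by
  refine rewrite (w' := []) ?_ ?_ u v g c hw
  · intro v g c h
    rcases of_cons_inr h with
      ⟨a, b, c', hab, hv, rfl⟩ | ⟨a, b, p, q, c₁, c₂, hpq, hab, hp, hq, rfl⟩
    · rcases of_cons_inr hv with
        ⟨a', b', c'', hab', h', rfl⟩ | ⟨a', b', r, s, d₁, d₂, rfl, hab', hr, hs, rfl⟩
      · refine h'.of_dist ?_
        have hr := rel_mul (rel_inv hab) (rel_swap_neg hab')
        have h₁ := D.norm_le hr
        have h₂ : D.norm (a'⁻¹ * b) = D.norm (a⁻¹ * b') := by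
          rw [← D.norm_eq hr, ← D.norm_inv]
          group
        have h₃ : D.norm ((a' * b'⁻¹ * (a * b⁻¹ * g))⁻¹ * g) =
            D.norm ((a'⁻¹ * b) * (a⁻¹ * b')) := by
          rw [← D.norm_conj _ (a'⁻¹ * g), D.norm_mul_comm, ← D.norm_mul_comm]
          group
        have h₄ := D.norm_mul_le (a'⁻¹ * b) (a⁻¹ * b')
        linarith
      · rw [neg_neg] at *
        exact (hr.append (hs.erase (rel_mul (rel_inv (rel_swap_neg hab')) hab))).congr
          (by group) (by ring)
    · rcases p with _ | ⟨l, p⟩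
      · obtain rfl : v = q := by simpa using hpq
        refine hq.of_dist ?_
        have := hp.norm_le_of_nil
        rw [← D.norm_eq hab] at this
        have h : D.norm ((b⁻¹ * g)⁻¹ * g) = D.norm b := by
          rw [D.norm_mul_comm]
          group
        linarith
      · obtain ⟨rfl, rfl⟩ : inr (-ε) = l ∧ v = p ++ inr (-ε) :: q := by simpa using hpq
        rcases of_cons_inr hp with
          ⟨a', b', c'', hab', h', rfl⟩ | ⟨a', b', r, s, d₁, d₂, rfl, hab', hr, hs, rfl⟩
        · exact (h'.append (hq.erase (rel_mul (rel_inv (D.rel_swap hab)) hab'))).congr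
            (by group) (by ring)
        · rw [neg_neg] at *
          have := rel_mul (rel_inv (rel_swap_neg hab')) hab
          exact (hr.append (hs.pair this hq)).congr_word (by simp) (by group)
            |>.congr rfl (by ring)
  · intro w₁ w₂ η hη u v a b g c₁ c₂ hab hu hv
    rcases w₁ with _ | ⟨l, _ | ⟨l', w₁⟩⟩
    · obtain ⟨rfl, rfl⟩ : ε = -η ∧ [inr (-ε)] = w₂ := by simpa using hη
      rw [List.append_nil] at hu
      rw [neg_neg] at hv
      rcases of_cons_inr hv with
        ⟨a', b', c', hab', h, rfl⟩ | ⟨a', b', p, q, d₁, d₂, rfl, hab', hp, hq, rfl⟩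
      · exact ((hu.append h).erase (rel_mul hab hab')).congr (by group) (by ring)
      · exact ((hu.append hp).pair (rel_mul hab hab') hq).congr_word (by simp) (by group)
          |>.congr rfl (by ring)
    · obtain ⟨rfl, rfl, rfl⟩ : inr ε = l ∧ ε = η ∧ [] = w₂ := by simpa using hη
      exact (rotate hu hab).append hv
    · simp at hη

theorem move_inr (hab : (a, b) ∈ D.rel ε) (u v : List (G ⊕ ℤˣ)) (g : G) (c : ℝ)
    (hw : D.Evaluates (u ++ ([inr ε, inl a] ++ v)) g c) :
    D.Evaluates (u ++ ([inl b, inr ε] ++ v)) g c := by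
  refine rewrite ?_ ?_ u v g c hw
  · intro v g c h
    refine cons_inl ?_
    rcases of_cons_inr h with
      ⟨a', b', c', hab', hv, rfl⟩ | ⟨a', b', p, q, c₁, c₂, hpq, hab', hp, hq, rfl⟩
    · exact (hv.of_cons_inl.erase (rel_mul (rel_inv hab) hab')).congr (by group) rfl
    · rcases p with _ | ⟨l, p⟩
      · simp at hpq
      · obtain ⟨rfl, rfl⟩ : inl a = l ∧ v = p ++ inr (-ε) :: q := by simpa using hpq
        exact (hp.of_cons_inl.pair (rel_mul (rel_inv hab) hab') hq).congr (by group) rfl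
  · intro w₁ w₂ η hη u v x y g c₁ c₂ hxy hu hv
    rcases w₁ with _ | ⟨l, _ | ⟨l', w₁⟩⟩
    · obtain ⟨rfl, rfl⟩ : ε = -η ∧ [inl a] = w₂ := by simpa using hη
      rw [List.append_nil] at hu
      have hb : D.Evaluates [inl b] b 0 := cons_inl (.nil (by simp [D.norm_one]))
      have := (hu.append hb).pair (rel_mul hxy (rel_swap_neg hab)) hv.of_cons_inl
      exact (this.congr_word (by simp) (by group)).congr rfl (by ring)
    · simp at hη
    · simp at hη

theorem move_inr_symm (hab : (a, b) ∈ D.rel ε) (u v : List (G ⊕ ℤˣ)) (g : G) (c : ℝ)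
    (hw : D.Evaluates (u ++ ([inl b, inr ε] ++ v)) g c) :
    D.Evaluates (u ++ ([inr ε, inl a] ++ v)) g c := by
  have h₁ := insert_inr ε _ _ _ _ hw
  have h₂ := move_inr (D.rel_swap hab) (u ++ [inr ε]) (inr ε :: v) g c (by simpa using h₁)
  have h₃ := cancel_inr (-ε) (u ++ [inr ε, inl a]) v g c (by simpa using h₂)
  simpa using h₃

end Evaluates
end HNNNormData

namespace HNNNormData

variable {G : Type*} [Group G] (D : HNNNormData G)

/-- Two words are congruent if they can be exchanged inside any word without changing the
possible evaluations and their costs. -/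
def con : Con (FreeMonoid (G ⊕ ℤˣ)) where
  r w w' := ∀ u v g c,
    D.Evaluates (u ++ (w.toList ++ v)) g c ↔ D.Evaluates (u ++ (w'.toList ++ v)) g c
  iseqv :=
    ⟨fun _ _ _ _ _ => Iff.rfl, fun h u v g c => (h u v g c).symm,
      fun h h' u v g c => (h u v g c).trans (h' u v g c)⟩
  mul' {w w' z z'} h h' u v g c := by
    have h₁ := h u (z.toList ++ v) g c
    have h₂ := h' (u ++ w'.toList) v g c
    simp only [FreeMonoid.toList_mul, List.append_assoc] at h₁ h₂ ⊢
    exact h₁.trans h₂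

/-- The base group maps to the quotient of the monoid of words. -/
def conOf : G →* D.con.Quotient where
  toFun g := D.con.mk' (FreeMonoid.of (inl g))
  map_one' := (Con.eq _).2 fun u v g c =>
    ⟨Evaluates.rewrite_base (l := [1]) (l' := [])
      (fun _ _ _ h => by simpa using h.of_cons_inl) u v g c,
    Evaluates.rewrite_base (l := []) (l' := [1])
      (fun _ _ _ h => Evaluates.cons_inl (by simpa using h)) u v g c⟩
  map_mul' x y := by
    rw [← map_mul]
    exact (Con.eq _).2 fun u v g c =>
      ⟨Evaluates.rewrite_base (l := [x * y]) (l' := [x, y])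
        (fun _ _ _ h => Evaluates.cons_inl (Evaluates.cons_inl
          (h.of_cons_inl.congr (by group) rfl))) u v g c,
      Evaluates.rewrite_base (l := [x, y]) (l' := [x * y])
        (fun _ _ _ h => Evaluates.cons_inl
          (h.of_cons_inl.of_cons_inl.congr (by group) rfl)) u v g c⟩

/-- The stable letter is invertible in the quotient of the monoid of words. -/
def conT : D.con.Quotientˣ where
  val := D.con.mk' (FreeMonoid.of (inr 1))
  inv := D.con.mk' (FreeMonoid.of (inr (-1)))
  val_inv := by
    rw [← map_mul, ← map_one D.con.mk']
    exact (Con.eq _).2 fun u v g c =>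
      ⟨Evaluates.cancel_inr 1 u v g c, Evaluates.insert_inr 1 u v g c⟩
  inv_val := by
    rw [← map_mul, ← map_one D.con.mk']
    exact (Con.eq _).2 fun u v g c =>
      ⟨Evaluates.cancel_inr (-1) u v g c, Evaluates.insert_inr (-1) u v g c⟩

section

variable {A B : Subgroup G} (φ : A ≃* B)

/-- The element of the HNN extension represented by a word. -/
def eval : FreeMonoid (G ⊕ ℤˣ) →* HNNExtension G A B φ :=
  FreeMonoid.lift (Sum.elim HNNExtension.of fun ε => HNNExtension.t ^ (ε : ℤ))

@[simp]
theorem eval_of_inl (g : G) : eval φ (FreeMonoid.of (inl g)) = HNNExtension.of g := by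
  simp [eval]

@[simp]
theorem eval_of_inr (ε : ℤˣ) :
    eval φ (FreeMonoid.of (inr ε)) = HNNExtension.t ^ (ε : ℤ) := by
  simp [eval]

variable {φ}

/-- The HNN extension maps to the quotient of the monoid of words. -/
def conLift (hφ : ∀ a : A, ((a : G), (φ a : G)) ∈ D.rel 1) :
    HNNExtension G A B φ →* D.con.Quotientˣ :=
  HNNExtension.lift D.conOf.toHomUnits D.conT fun a => by
    ext
    exact (Con.eq _).2 fun u v g c =>
      ⟨Evaluates.move_inr (hφ a) u v g c, Evaluates.move_inr_symm (hφ a) u v g c⟩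

variable {D}

theorem conLift_eval (hφ : ∀ a : A, ((a : G), (φ a : G)) ∈ D.rel 1)
    (w : FreeMonoid (G ⊕ ℤˣ)) : (D.conLift hφ (eval φ w) : D.con.Quotient) = D.con.mk' w := by
  suffices h : (Units.coeHom _).comp ((D.conLift hφ).comp (eval φ)) = D.con.mk' from
    DFunLike.congr_fun h w
  refine FreeMonoid.hom_eq fun l => ?_
  rcases l with x | ε
  · simp [conLift, conOf]
  · rcases Int.units_eq_one_or ε with rfl | rfl <;> simp [conLift, conT]

theorem Evaluates.of_eval_eq (hφ : ∀ a : A, ((a : G), (φ a : G)) ∈ D.rel 1)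
    {w w' : FreeMonoid (G ⊕ ℤˣ)} (h : eval φ w = eval φ w') {g : G} {c : ℝ}
    (hw : D.Evaluates w.toList g c) : D.Evaluates w'.toList g c := by
  have hc : D.con w w' := (Con.eq _).1 <| by
    rw [← D.con.coe_mk', ← conLift_eval hφ, h, conLift_eval]
  simpa using (hc [] [] g c).1 (by simpa using hw)

theorem eval_surjective : Function.Surjective (eval φ) := by
  intro h
  induction h using HNNExtension.induction_on with
  | of g => exact ⟨_, eval_of_inl φ g⟩
  | t => exact ⟨_, (eval_of_inr φ 1).trans (by simp)⟩
  | mul x y hx hy =>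
    obtain ⟨⟨w, rfl⟩, ⟨w', rfl⟩⟩ := hx, hy
    exact ⟨w * w', map_mul _ _ _⟩
  | inv x hx =>
    obtain ⟨w, rfl⟩ := hx
    induction w using FreeMonoid.inductionOn' with
    | one => exact ⟨1, by simp⟩
    | of_mul l w ih =>
      obtain ⟨w', hw'⟩ := ih
      rcases l with g | ε
      · exact ⟨w' * FreeMonoid.of (inl g⁻¹), by simp [hw']⟩
      · exact ⟨w' * FreeMonoid.of (inr (-ε)), by simp [hw']⟩

variable (D)

/-- The costs of evaluating to `1` the words representing an element of the HNN extension. -/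
def costs (h : HNNExtension G A B φ) : Set ℝ :=
  {c | ∃ w : FreeMonoid (G ⊕ ℤˣ), eval φ w = h ∧ D.Evaluates w.toList 1 c}

/-- The extension of the norm to the HNN extension. -/
noncomputable def hnnNorm (h : HNNExtension G A B φ) : ℝ :=
  sInf (D.costs h)

theorem costs_nonempty (h : HNNExtension G A B φ) : (D.costs h).Nonempty := by
  obtain ⟨w, hw⟩ := eval_surjective h
  obtain ⟨c, hc⟩ := Evaluates.exists_cost (D := D) w.toList 1
  exact ⟨c, w, hw, hc⟩

theorem bddBelow_costs (h : HNNExtension G A B φ) : BddBelow (D.costs h) :=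
  ⟨0, fun _ ⟨_, _, hc⟩ => hc.nonneg⟩

theorem hnnNorm_le_of_subset {h k : HNNExtension G A B φ} (hkh : D.costs k ⊆ D.costs h) :
    D.hnnNorm h ≤ D.hnnNorm k :=
  csInf_le_csInf (D.bddBelow_costs h) (D.costs_nonempty k) hkh

open scoped Pointwise in
theorem hnnNorm_mul_le (h k : HNNExtension G A B φ) :
    D.hnnNorm (h * k) ≤ D.hnnNorm h + D.hnnNorm k := by
  rw [hnnNorm, hnnNorm, hnnNorm, ← csInf_add (D.costs_nonempty h) (D.bddBelow_costs h)
    (D.costs_nonempty k) (D.bddBelow_costs k)]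
  refine csInf_le_csInf (D.bddBelow_costs _) ((D.costs_nonempty h).add (D.costs_nonempty k)) ?_
  rintro _ ⟨c, ⟨w, rfl, hw⟩, c', ⟨w', rfl, hw'⟩, rfl⟩
  exact ⟨w * w', map_mul _ _ _, (hw.append hw').congr (one_mul 1) rfl⟩

variable {D} in
theorem Evaluates.exists_inv {l : List (G ⊕ ℤˣ)} {g : G} {c : ℝ} (hl : D.Evaluates l g c) :
    ∃ w : FreeMonoid (G ⊕ ℤˣ), eval φ w = (eval φ (FreeMonoid.ofList l))⁻¹ ∧
      D.Evaluates w.toList g⁻¹ c := by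
  induction hl with
  | nil hg => exact ⟨1, by simp, .nil (by rwa [D.norm_inv])⟩
  | @base x g l c _ ih =>
    obtain ⟨w, hw, hwg⟩ := ih
    exact ⟨w * FreeMonoid.of (inl x⁻¹), by simp [hw],
      (hwg.append (base (.nil D.norm_one.le))).congr (by simp) (by simp)⟩
  | @erase ε a b g l c hab _ ih =>
    obtain ⟨w, hw, hwg⟩ := ih
    exact ⟨w * FreeMonoid.of (inr (-ε)), by simp [hw],
      (hwg.append (erase (D.rel_swap hab) (.nil D.norm_one.le))).congr (by simp) (by simp)⟩
  | @pair ε a b g u v c c' hab _ _ ihu ihv =>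
    obtain ⟨⟨u', hu, hua⟩, ⟨v', hv, hvg⟩⟩ := ihu, ihv
    refine ⟨v' * (FreeMonoid.of (inr ε) * (u' * FreeMonoid.of (inr (-ε)))), ?_,
      (hvg.append (pair (rel_inv hab) hua (.nil D.norm_one.le))).congr (by simp) (by ring)⟩
    simp [hu, hv, mul_assoc]

theorem hnnNorm_inv (h : HNNExtension G A B φ) : D.hnnNorm h⁻¹ = D.hnnNorm h := by
  have key (h : HNNExtension G A B φ) : D.hnnNorm h⁻¹ ≤ D.hnnNorm h := by
    refine D.hnnNorm_le_of_subset ?_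
    rintro c ⟨w, rfl, hw⟩
    obtain ⟨w', h₁, h₂⟩ := hw.exists_inv (φ := φ)
    exact ⟨w', h₁, by simpa using h₂⟩
  exact (key h).antisymm (by simpa using key h⁻¹)

theorem hnnNorm_conj (h k : HNNExtension G A B φ) :
    D.hnnNorm (k * h * k⁻¹) = D.hnnNorm h := by
  have key (h k : HNNExtension G A B φ) : D.hnnNorm (k * h * k⁻¹) ≤ D.hnnNorm h := by
    obtain ⟨w, rfl⟩ := eval_surjective k
    induction w using FreeMonoid.inductionOn' with
    | one => simp
    | of_mul l w ih =>
      refine le_trans (D.hnnNorm_le_of_subset ?_) ih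
      rintro c ⟨z, hz, hc⟩
      rcases l with x | ε
      · refine ⟨FreeMonoid.of (inl x) * (z * FreeMonoid.of (inl x⁻¹)), ?_, ?_⟩
        · simp [hz, mul_assoc]
        · exact (Evaluates.base (hc.append (Evaluates.base (.nil D.norm_one.le)))).congr
            (by simp) (add_zero c)
      · refine ⟨FreeMonoid.of (inr ε) * (z * FreeMonoid.of (inr (-ε))), ?_, ?_⟩
        · simp [hz, mul_assoc]
        · exact (Evaluates.pair (one_mem (D.rel ε)) hc (.nil D.norm_one.le)).congr
            (by simp) (add_zero c)
  refine (key h k).antisymm ?_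
  simpa [mul_assoc] using key (k * h * k⁻¹) k⁻¹

variable {D}

theorem hnnNorm_eval (hφ : ∀ a : A, ((a : G), (φ a : G)) ∈ D.rel 1)
    {w : FreeMonoid (G ⊕ ℤˣ)} {c : ℝ} (hc : IsLeast {c | D.Evaluates w.toList 1 c} c) :
    D.hnnNorm (eval φ w) = c := by
  rw [← hc.csInf_eq]
  refine congrArg sInf (Set.ext fun c => ?_)
  exact ⟨fun ⟨w', hw', h⟩ => h.of_eval_eq hφ hw', fun h => ⟨w, rfl, h⟩⟩

theorem hnnNorm_of (hφ : ∀ a : A, ((a : G), (φ a : G)) ∈ D.rel 1) (g : G) :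
    D.hnnNorm (HNNExtension.of g : HNNExtension G A B φ) = D.norm g := by
  rw [← eval_of_inl]
  refine hnnNorm_eval hφ ⟨.cons_inl (.nil (by simp [D.norm_inv])), fun c hc => ?_⟩
  simpa [D.norm_inv] using (Evaluates.of_cons_inl hc).norm_le_of_nil

theorem hnnNorm_t (hφ : ∀ a : A, ((a : G), (φ a : G)) ∈ D.rel 1) :
    D.hnnNorm (HNNExtension.t : HNNExtension G A B φ) = D.K := by
  have ht : (HNNExtension.t : HNNExtension G A B φ) = eval φ (FreeMonoid.of (inr 1)) := by simp
  rw [ht]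
  refine hnnNorm_eval hφ ⟨?_, fun c hc => ?_⟩
  · exact (Evaluates.erase (one_mem (D.rel 1)) (.nil D.norm_one.le)).congr (by simp) (by simp)
  · rcases Evaluates.of_cons_inr hc with ⟨a, b, c', _, h, rfl⟩ | ⟨a, b, u, v, _, _, h, _⟩
    · linarith [h.nonneg]
    · simp at h

theorem eval_word (l : List (ℤˣ × G)) : eval φ (FreeMonoid.ofList (word l)) =
    (l.map fun p => HNNExtension.t ^ (p.1 : ℤ) * HNNExtension.of p.2).prod := by
  induction l with
  | nil => simp [word]
  | cons p l ih => simp [word_cons, ih, mul_assoc]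

/-- A cheap evaluation of a reduced word cannot involve the stable letter: a metric version of
Britton's lemma. -/
theorem Evaluates.eq_nil {δ : ℝ} (hδ : δ ≤ D.K) (l : List (ℤˣ × G))
    (hl : l.IsChain fun p q => p.2 ∈ HNNExtension.toSubgroup A B p.1 → p.1 = q.1)
    (hlδ : ∀ p ∈ l, p.2 ∉ HNNExtension.toSubgroup A B p.1 →
      ∀ a b, (a, b) ∈ D.rel p.1 → δ ≤ D.norm (p.2⁻¹ * a))
    {x : G} {c : ℝ} (hw : D.Evaluates (word l) x c) (hc : c < δ) : l = [] := by
  induction hn : l.length using Nat.strong_induction_on generalizing l x c with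
  | _ n ih =>
  subst hn
  rcases l with _ | ⟨⟨ε, g⟩, l⟩
  · rfl
  exfalso
  rcases of_cons_inr hw with
    ⟨a, b, c', _, h, rfl⟩ | ⟨a, b, u, v, c₁, c₂, huv, hab, hu, hv, rfl⟩
  · linarith [h.nonneg]
  rcases u with _ | ⟨z, u⟩
  · simp at huv
  obtain ⟨rfl, huv'⟩ : inl g = z ∧ word l = u ++ inr (-ε) :: v := List.cons.inj huv
  obtain ⟨l₁, y, l₂, rfl, rfl⟩ := exists_of_word_eq_append huv'
  have hc₁ : c₁ < δ := by linarith [hv.nonneg]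
  have hu' := hu.of_cons_inl
  obtain rfl : l₁ = [] := by
    refine ih l₁.length (by simp) l₁ (List.IsChain.left_of_append hl.tail) (fun p hp => ?_)
      hu' hc₁ rfl
    exact hlδ p (by simp [hp])
  have hg : g ∈ HNNExtension.toSubgroup A B ε := by
    by_contra hg
    have : δ ≤ D.norm (g⁻¹ * a) := hlδ (ε, g) (by simp) hg a b hab
    have : D.norm (g⁻¹ * a) ≤ c₁ := norm_le_of_nil hu'
    linarith
  exact units_ne_neg_self ε ((List.isChain_cons_cons.1 hl).1 hg)

theorem eq_one_of_hnnNorm_eq_zero (hφ : ∀ a : A, ((a : G), (φ a : G)) ∈ D.rel 1)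
    (hD : ∀ g, D.norm g = 0 → g = 1) (hK : 0 < D.K)
    (hclosed : ∀ (ε : ℤˣ) (g : G), g ∉ HNNExtension.toSubgroup A B ε →
      ∃ δ > 0, ∀ a b, (a, b) ∈ D.rel ε → δ ≤ D.norm (g⁻¹ * a))
    {h : HNNExtension G A B φ} (hh : D.hnnNorm h = 0) : h = 1 := by
  obtain ⟨T⟩ := HNNExtension.NormalWord.TransversalPair.nonempty G A B
  obtain ⟨⟨g, l, hl⟩, rfl⟩ : ∃ w : HNNExtension.NormalWord.ReducedWord G A B, w.prod φ = h :=
    ⟨_, (HNNExtension.NormalWord.equiv φ T).left_inv h⟩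
  obtain ⟨δ, hδ, hδK, hlδ⟩ : ∃ δ > 0, δ ≤ D.K ∧ ∀ p ∈ l,
      p.2 ∉ HNNExtension.toSubgroup A B p.1 →
        ∀ a b, (a, b) ∈ D.rel p.1 → δ ≤ D.norm (p.2⁻¹ * a) := by
    clear hh hl
    induction l with
    | nil => exact ⟨D.K, hK, le_rfl, by simp⟩
    | cons p l ih =>
      obtain ⟨δ, hδ, hδK, hlδ⟩ := ih
      by_cases hp : p.2 ∈ HNNExtension.toSubgroup A B p.1
      · exact ⟨δ, hδ, hδK, List.forall_mem_cons.2 ⟨fun h => absurd hp h, hlδ⟩⟩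
      · obtain ⟨δ', hδ', hpδ⟩ := hclosed _ _ hp
        refine ⟨min δ δ', lt_min hδ hδ', min_le_of_left_le hδK, List.forall_mem_cons.2
          ⟨fun _ a b hab => min_le_of_right_le (hpδ a b hab), fun q hq hq' a b hab =>
            min_le_of_left_le (hlδ q hq hq' a b hab)⟩⟩
  have hw : eval φ (FreeMonoid.ofList (inl g :: word l)) =
      HNNExtension.NormalWord.ReducedWord.prod φ ⟨g, l, hl⟩ := by
    simp [HNNExtension.NormalWord.ReducedWord.prod, eval_word]
  obtain ⟨c, ⟨w, hw', hc⟩, hcδ⟩ := exists_lt_of_csInf_lt (D.costs_nonempty _) (hh.trans_lt hδ)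
  have hgl := hc.of_eval_eq hφ (hw'.trans hw.symm)
  obtain rfl := hgl.of_cons_inl.eq_nil hδK l hl hlδ hcδ
  have hg : HNNExtension.NormalWord.ReducedWord.prod φ ⟨g, [], hl⟩ = HNNExtension.of g := by
    simp [HNNExtension.NormalWord.ReducedWord.prod]
  rw [hg, hnnNorm_of hφ] at hh
  rw [hg, hD g hh, map_one]

end

end HNNNormData

theorem IsTSIMetric.map_mul_inv {G : Type*} [Group G] {d : G → G → ℝ} (hd : IsTSIMetric d)
    (g h : G) : d (g * h⁻¹) 1 = d g h := by
  simpa using (hd.2.2.2.2 h (g * h⁻¹) 1).symm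

theorem IsTSIMetric.map_inv_mul {G : Type*} [Group G] {d : G → G → ℝ} (hd : IsTSIMetric d)
    (g h : G) : d (g⁻¹ * h) 1 = d h g := by
  simpa using hd.2.2.2.1 g⁻¹ h g

/-- A two-sided invariant metric and a partial isometric isomorphism yield a norm and the graphs
of conjugation by the stable letter. -/
def IsTSIMetric.hnnNormData {G : Type*} [Group G] {d : G → G → ℝ} (hd : IsTSIMetric d)
    {A B : Subgroup G} (φ : A ≃* B) (hiso : ∀ a a' : A, d ↑(φ a) ↑(φ a') = d ↑a ↑a')
    (K : ℝ) (hdiam : ∀ a a' : A, d ↑a ↑a' ≤ K) : HNNNormData G where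
  norm g := d g 1
  norm_one := (hd.1 1 1).2 rfl
  norm_inv g := by
    rw [hd.2.1 g 1, ← hd.map_mul_inv 1 g, one_mul]
  norm_mul_le g h := by
    have := hd.2.2.1 (g * h) h 1
    rwa [← hd.map_mul_inv (g * h) h, mul_inv_cancel_right] at this
  norm_conj g h := by
    rw [hd.map_mul_inv]
    simpa using hd.2.2.2.1 h g 1
  K := K
  rel ε := ((HNNExtension.toSubgroup A B ε).subtype.prod
    ((HNNExtension.toSubgroup A B (-ε)).subtype.comp
      (HNNExtension.toSubgroupEquiv φ ε).toMonoidHom)).range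
  rel_swap := by
    rintro ε _ _ ⟨a, h⟩
    obtain ⟨rfl, rfl⟩ := Prod.mk.inj h
    exact ⟨HNNExtension.toSubgroupEquiv φ ε a,
      Prod.ext rfl (HNNExtension.toSubgroupEquiv_neg_apply φ ε a)⟩
  norm_eq := by
    have key (a : A) : d (φ a) 1 = d a 1 := by simpa using hiso a 1
    have key' (b : B) : d (φ.symm b) 1 = d b 1 := by simpa using (key (φ.symm b)).symm
    rintro ε _ _ ⟨a, h⟩
    obtain ⟨rfl, rfl⟩ := Prod.mk.inj h
    rcases Int.units_eq_one_or ε with rfl | rfl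
    · exact key a
    · exact key' a
  norm_le := by
    have key (b : B) : d b 1 ≤ K := by
      simpa using (hiso (φ.symm b) 1).trans_le (hdiam (φ.symm b) 1)
    rintro ε _ _ ⟨a, h⟩
    obtain ⟨rfl, rfl⟩ := Prod.mk.inj h
    rcases Int.units_eq_one_or ε with rfl | rfl
    · exact hdiam a 1
    · exact key a

theorem IsDClosed.exists_le {G : Type*} {d : G → G → ℝ} {S : Set G} (hS : IsDClosed d S)
    {x : G} (hx : x ∉ S) : ∃ δ > 0, ∀ s ∈ S, δ ≤ d x s := by
  by_contra! h
  exact hx (hS x h)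

/-- **Two-sided invariant metrics extend to HNN extensions of bounded isometric type.**  If
`(G, d)` is a tsi group, `φ : A ≃ B` is a `d`-isometric isomorphism between closed subgroups,
and `diam A ≤ K` for some `K > 0`, then the HNN extension `H` of `(G, φ)` carries a two-sided
invariant metric extending `d` with the stable letter at distance `K` from the identity. -/
theorem hnn_extension_tsi_metric {G : Type*} [Group G] (d : G → G → ℝ) (hd : IsTSIMetric d)
    (A B : Subgroup G) (hA : IsDClosed d (A : Set G)) (hB : IsDClosed d (B : Set G))
    (φ : A ≃* B) (hiso : ∀ a a' : A, d ↑(φ a) ↑(φ a') = d ↑a ↑a')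
    (K : ℝ) (hK : 0 < K) (hdiam : ∀ a a' : A, d ↑a ↑a' ≤ K) :
    ∃ dbar : HNNExtension G A B φ → HNNExtension G A B φ → ℝ,
      IsTSIMetric dbar ∧
      (∀ g h : G, dbar (HNNExtension.of g) (HNNExtension.of h) = d g h) ∧
      dbar (HNNExtension.t (φ := φ)) 1 = K := by
  set D := hd.hnnNormData φ hiso K hdiam
  have hφ (a : A) : ((a : G), (φ a : G)) ∈ D.rel 1 := ⟨a, rfl⟩
  have hclosed (ε : ℤˣ) (g : G) (hg : g ∉ HNNExtension.toSubgroup A B ε) :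
      ∃ δ > 0, ∀ a b, (a, b) ∈ D.rel ε → δ ≤ D.norm (g⁻¹ * a) := by
    have hε : IsDClosed d (HNNExtension.toSubgroup A B ε : Set G) := by
      rcases Int.units_eq_one_or ε with rfl | rfl
      · exact hA
      · exact hB
    obtain ⟨δ, hδ, h⟩ := hε.exists_le hg
    refine ⟨δ, hδ, ?_⟩
    rintro _ _ ⟨a, hab⟩
    obtain ⟨rfl, rfl⟩ := Prod.mk.inj hab
    exact ((h a a.2).trans_eq (hd.2.1 _ _)).trans_eq (hd.map_inv_mul _ _).symm
  refine ⟨fun x y => D.hnnNorm (x * y⁻¹), ⟨fun x y => ⟨fun h => ?_, ?_⟩, fun x y => ?_,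
    fun x y z => ?_, fun g x y => ?_, fun g x y => ?_⟩, fun g h => ?_, ?_⟩ <;> beta_reduce
  · exact mul_inv_eq_one.1 <|
      D.eq_one_of_hnnNorm_eq_zero hφ (fun g => (hd.1 g 1).1) hK hclosed h
  · rintro rfl
    rw [mul_inv_cancel, ← map_one HNNExtension.of, D.hnnNorm_of hφ, D.norm_one]
  · rw [← D.hnnNorm_inv]
    simp
  · simpa using D.hnnNorm_mul_le (x * y⁻¹) (y * z⁻¹)
  · rw [← D.hnnNorm_conj (x * y⁻¹) g]
    simp [mul_assoc]
  · simp [mul_assoc]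
  · rw [← map_inv, ← map_mul, D.hnnNorm_of hφ]
    exact hd.map_mul_inv g h
  · rw [inv_one, mul_one, D.hnnNorm_t hφ]
    rfl
end

section
/- Let G be a group and let P = G * ⟨t⟩ be the free product of G with an infinite cyclic group generated by t. Let w₁, …, w_n be elements of P such that each w_i either lies in (the image of) G or belongs to {t, t⁻¹} (a hereditary word). If w₁ · w₂ ⋯ w_n = 1 in P and w_i = t for some i, then there exist indices 1 ≤ p < q ≤ n such that w_p ∈ {t, t⁻¹}, w_q = w_p⁻¹, w_i ∈ G for all i with p < i < q, and w_p · w_{p+1} ⋯ w_q = 1. -/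
open Monoid.Coprod in
/-- A word in `G ∗ ⟨t⟩` either contains a trivial pinch `t ^ u * 1 * t ^ (-u)` or defines a reduced
word of the HNN extension of `G` along trivial subgroups. -/
theorem exists_pinch_or_reducedWord {G ι : Type*} [Group G]
    (w : ι → Monoid.Coprod G (Multiplicative ℤ)) (l : List ι)
    (hw : ∀ i ∈ l, w i ∈ Set.range inl ∨
      ∃ u : ℤˣ, w i = inr (Multiplicative.ofAdd (u : ℤ))) :
    (∃ (l₁ m l₂ : List ι) (p q : ι) (u : ℤˣ), l = l₁ ++ p :: (m ++ q :: l₂) ∧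
      w p = inr (Multiplicative.ofAdd (u : ℤ)) ∧ w q = (w p)⁻¹ ∧
      (∀ i ∈ m, w i ∈ Set.range inl) ∧ (m.map w).prod = 1) ∨
    ∃ r : HNNExtension.NormalWord.ReducedWord G ⊥ ⊥,
      lift HNNExtension.of (zpowersHom _ HNNExtension.t) (l.map w).prod =
        r.prod (MulEquiv.refl (⊥ : Subgroup G)) ∧
      (r.toList = [] → (∀ i ∈ l, w i ∈ Set.range inl) ∧ (l.map w).prod = inl r.head) ∧
      ∀ (u : ℤˣ) (g : G) (s : List (ℤˣ × G)), r.toList = (u, g) :: s →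
        ∃ (m : List ι) (j : ι) (l' : List ι), l = m ++ j :: l' ∧
          w j = inr (Multiplicative.ofAdd (u : ℤ)) ∧
          (∀ i ∈ m, w i ∈ Set.range inl) ∧ (m.map w).prod = inl r.head := by
  induction l with
  | nil =>
    exact .inr ⟨.empty G ⊥ ⊥, by simp [HNNExtension.NormalWord.ReducedWord.prod,
      HNNExtension.NormalWord.ReducedWord.empty]⟩
  | cons a l ih =>
    obtain ⟨l₁, m, l₂, p, q, u, rfl, h⟩ | ⟨r, hprod, hnil, hcons⟩ :=
      ih fun i hi => hw i (List.mem_cons_of_mem a hi)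
    · exact .inl ⟨a :: l₁, m, l₂, p, q, u, rfl, h⟩
    obtain ⟨g, hg⟩ | ⟨u, hu⟩ := hw a List.mem_cons_self
    · refine .inr ⟨{ r with head := g * r.head }, ?_, fun h => ?_, fun u g' s h => ?_⟩
      · rw [List.map_cons, List.prod_cons, map_mul, hprod, ← hg]
        simp [HNNExtension.NormalWord.ReducedWord.prod, mul_assoc]
      · obtain ⟨h₁, h₂⟩ := hnil h
        exact ⟨List.forall_mem_cons.2 ⟨⟨g, hg⟩, h₁⟩, by simp [h₂, ← hg]⟩
      · obtain ⟨m, j, l', rfl, hj, hm, hm'⟩ := hcons u g' s h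
        refine ⟨a :: m, j, l', rfl, hj, ?_, by simp [hm', ← hg]⟩
        rintro i (_ | ⟨_, hi⟩)
        exacts [⟨g, hg⟩, hm i ‹_›]
    by_cases hp : ∃ g s, r.head = 1 ∧ r.toList = (-u, g) :: s
    · obtain ⟨g, s, hr, hs⟩ := hp
      obtain ⟨m, j, l', rfl, hj, hm, hm'⟩ := hcons _ _ _ hs
      refine .inl ⟨[], m, l', a, j, u, rfl, hu, ?_, hm, by simp [hm', hr]⟩
      rw [hu, hj, ← map_inv, ← ofAdd_neg, Units.val_neg]
    · refine .inr ⟨⟨1, (u, r.head) :: r.toList, ?_⟩, ?_, by simp, ?_⟩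
      · cases hs : r.toList with
        | nil => simp
        | cons b s =>
          have hc := r.chain
          rw [hs] at hc
          refine List.isChain_cons_cons.2 ⟨fun hmem => ?_, hc⟩
          have h1 : r.head = 1 := by
            change r.head ∈ HNNExtension.toSubgroup ⊥ ⊥ u at hmem
            rcases Int.units_eq_one_or u with rfl | rfl <;> simpa using hmem
          by_contra hne
          refine hp ⟨b.2, s, h1, ?_⟩
          rw [hs, ← Int.units_ne_iff_eq_neg.1 (Ne.symm hne)]
      · rw [List.map_cons, List.prod_cons, map_mul, hprod]
        simp [hu, HNNExtension.NormalWord.ReducedWord.prod, mul_assoc]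
      · rintro v g s ⟨⟩
        exact ⟨[], a, l, rfl, hu, by simp, by simp⟩

open Monoid.Coprod in
theorem inr_ofAdd_one_notMem_range_inl {G : Type*} [Group G] :
    (inr (Multiplicative.ofAdd (1 : ℤ)) : Monoid.Coprod G (Multiplicative ℤ)) ∉
      Set.range inl := by
  rintro ⟨g, hg⟩
  have : (1 : Multiplicative ℤ) = Multiplicative.ofAdd 1 := by simpa using congrArg snd hg
  exact absurd (Multiplicative.ofAdd.injective this) (by simp)

open Monoid.Coprod in
/-- A word in the letters `G ∪ {t, t⁻¹}` which evaluates to the identity of `G ∗ ⟨t⟩` and is not a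
word in `G` contains a trivial pinch. -/
theorem exists_pinch_of_prod_eq_one {G ι : Type*} [Group G]
    (w : ι → Monoid.Coprod G (Multiplicative ℤ)) (l : List ι)
    (hw : ∀ i ∈ l, w i ∈ Set.range inl ∨
      ∃ u : ℤˣ, w i = inr (Multiplicative.ofAdd (u : ℤ)))
    (hprod : (l.map w).prod = 1) (ht : ∃ i ∈ l, w i ∉ Set.range inl) :
    ∃ (l₁ m l₂ : List ι) (p q : ι) (u : ℤˣ), l = l₁ ++ p :: (m ++ q :: l₂) ∧
      w p = inr (Multiplicative.ofAdd (u : ℤ)) ∧ w q = (w p)⁻¹ ∧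
      (∀ i ∈ m, w i ∈ Set.range inl) ∧ (m.map w).prod = 1 := by
  refine (exists_pinch_or_reducedWord w l hw).resolve_right ?_
  rintro ⟨r, hr, hnil, -⟩
  obtain ⟨i, hi, hti⟩ := ht
  rw [hprod, map_one] at hr
  have hnil' := HNNExtension.ReducedWord.toList_eq_nil_of_mem_of_range _ r (hr ▸ one_mem _)
  exact hti ((hnil hnil').1 i hi)

/-- **Structure of trivial hereditary words in `G ∗ ⟨t⟩`.**  If a word `w₁ ⋯ w_n` in the free
product of `G` with the infinite cyclic group generated by `t = inr (ofAdd 1)` consists of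
letters that lie in `G` or in `{t, t⁻¹}`, evaluates to the identity, and contains the letter
`t`, then there is a subword `w_p ⋯ w_q` evaluating to the identity whose first and last letters
are mutually inverse elements of `{t, t⁻¹}` and whose interior letters all lie in `G`. -/
theorem hereditary_trivial_word_structure {G : Type*} [Group G] (n : ℕ)
    (w : Fin n → Monoid.Coprod G (Multiplicative ℤ))
    (hw : ∀ i : Fin n, (∃ g : G, w i = Monoid.Coprod.inl g) ∨
      w i = Monoid.Coprod.inr (Multiplicative.ofAdd (1 : ℤ)) ∨
      w i = (Monoid.Coprod.inr (Multiplicative.ofAdd (1 : ℤ)))⁻¹)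
    (hprod : ((List.finRange n).map w).prod = 1)
    (ht : ∃ i : Fin n, w i = Monoid.Coprod.inr (Multiplicative.ofAdd (1 : ℤ))) :
    ∃ p q : Fin n, p < q ∧
      (w p = Monoid.Coprod.inr (Multiplicative.ofAdd (1 : ℤ)) ∨
        w p = (Monoid.Coprod.inr (Multiplicative.ofAdd (1 : ℤ)))⁻¹) ∧
      w q = (w p)⁻¹ ∧
      (∀ i : Fin n, p < i → i < q → ∃ g : G, w i = Monoid.Coprod.inl g) ∧
      (((List.finRange n).filter (fun i => decide (p ≤ i ∧ i ≤ q))).map w).prod = 1 := by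
  obtain ⟨i₀, hi₀⟩ := ht
  obtain ⟨l₁, m, l₂, p, q, u, hl, hp, hq, hm, hm'⟩ :=
    exists_pinch_of_prod_eq_one w (List.finRange n) (fun i _ => by
      rcases hw i with ⟨g, hg⟩ | h | h
      · exact .inl ⟨g, hg.symm⟩
      · exact .inr ⟨1, by simpa using h⟩
      · exact .inr ⟨-1, by simpa using h⟩) hprod
      ⟨i₀, List.mem_finRange i₀, hi₀ ▸ inr_ofAdd_one_notMem_range_inl⟩
  have hsort : (List.finRange n).Pairwise (· < ·) := List.pairwise_lt_finRange n
  rw [hl] at hsort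
  simp only [List.pairwise_append, List.pairwise_cons, List.mem_append, List.mem_cons] at hsort
  obtain ⟨-, ⟨hp_lt, -, ⟨hq_lt, -⟩, hm_lt⟩, hl₁⟩ := hsort
  have hpq : p < q := hp_lt q (by simp)
  refine ⟨p, q, hpq, ?_, hq, fun i hpi hiq => ?_, ?_⟩
  · rcases Int.units_eq_one_or u with rfl | rfl
    · exact .inl (by simpa using hp)
    · exact .inr (by simpa using hp)
  · have hi := List.mem_finRange i
    rw [hl] at hi
    simp only [List.mem_append, List.mem_cons] at hi
    rcases hi with hi | rfl | hi | rfl | hi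
    · exact absurd (hl₁ i hi p (by simp)) hpi.asymm
    · exact absurd hpi (lt_irrefl _)
    · obtain ⟨g, hg⟩ := hm i hi
      exact ⟨g, hg.symm⟩
    · exact absurd hiq (lt_irrefl _)
    · exact absurd (hq_lt i hi) hiq.asymm
  · have h₁ : l₁.filter (fun i => decide (p ≤ i ∧ i ≤ q)) = [] := by
      refine List.filter_eq_nil_iff.2 fun i hi => ?_
      simpa using fun h : p ≤ i => absurd (hl₁ i hi p (by simp)) h.not_gt
    have h₂ : l₂.filter (fun i => decide (p ≤ i ∧ i ≤ q)) = [] := by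
      refine List.filter_eq_nil_iff.2 fun i hi => ?_
      simpa using fun _ : p ≤ i => hq_lt i hi
    have h₃ : m.filter (fun i => decide (p ≤ i ∧ i ≤ q)) = m := by
      refine List.filter_eq_self.2 fun i hi => ?_
      simpa using ⟨(hp_lt i (.inl hi)).le, (hm_lt i hi q (.inl rfl)).le⟩
    rw [hl]
    simp [-Bool.decide_and, h₁, h₂, h₃, hpq.le, hm', hq]
end

section
/- Let (G, d) be a group with a two-sided invariant metric, let A and B be closed subgroups of G, and let φ : A ≃ B be a group isomorphism with d(φ(a), φ(a')) = d(a, a') for all a, a' ∈ A. Let H be the HNN extension of G along φ, with canonical injective homomorphism of : G → H and stable letter t. If d' is a two-sided invariant metric on H with d'(of(g), of(h)) = d(g, h) for all g, h ∈ G, then d'(of(a), of(φ(a))) ≤ 2·d'(t, 1) for every a ∈ A; in particular sup_{a ∈ A} d'(of(a), of(φ(a))) < ∞. -/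
/-- For a two-sided invariant metric, conjugating by `t` moves any element by at most
`2 * d t 1`. -/
theorem IsTSIMetric.dist_conj_le {G : Type*} [Group G] {d : G → G → ℝ} (hd : IsTSIMetric d)
    (t x : G) : d x (t * x * t⁻¹) ≤ 2 * d t 1 := by
  obtain ⟨-, hsymm, htri, hleft, hright⟩ := hd
  have h₁ : d x (t * x) = d t 1 := by
    rw [hsymm t 1, ← hright x 1 t, one_mul]
  have h₂ : d (t * x) (t * x * t⁻¹) = d t 1 := by
    rw [← hright t, inv_mul_cancel_right, ← hleft (t * x) t 1, mul_one]
  linarith [htri x (t * x) (t * x * t⁻¹)]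

/-- **A necessary condition for extending a tsi metric to an HNN extension.**  If a two-sided
invariant metric `d'` on the HNN extension of `(G, φ)` extends the tsi metric `d` of `G`, then
`d'(a, φ(a)) ≤ 2 d'(t, 1)` for every `a ∈ A`; in particular
`sup_{a ∈ A} d'(a, φ(a)) < ∞`. -/
theorem hnn_extension_necessary_condition {G : Type*} [Group G]
    (d : G → G → ℝ) (hd : IsTSIMetric d)
    (A B : Subgroup G) (hA : IsDClosed d (A : Set G)) (hB : IsDClosed d (B : Set G))
    (φ : A ≃* B) (hiso : ∀ a a' : A, d ↑(φ a) ↑(φ a') = d ↑a ↑a')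
    (d' : HNNExtension G A B φ → HNNExtension G A B φ → ℝ) (hd' : IsTSIMetric d')
    (hext : ∀ g h : G, d' (HNNExtension.of g) (HNNExtension.of h) = d g h) :
    (∀ a : A, d' (HNNExtension.of (↑a : G)) (HNNExtension.of (↑(φ a) : G))
        ≤ 2 * d' (HNNExtension.t (φ := φ)) 1) ∧
      ∃ C : ℝ, ∀ a : A,
        d' (HNNExtension.of (↑a : G)) (HNNExtension.of (↑(φ a) : G)) ≤ C := by
  have hbound : ∀ a : A, d' (HNNExtension.of (↑a : G)) (HNNExtension.of (↑(φ a) : G))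
      ≤ 2 * d' (HNNExtension.t (φ := φ)) 1 := fun a => by
    rw [HNNExtension.equiv_eq_conj]
    exact hd'.dist_conj_le _ _
  exact ⟨hbound, _, hbound⟩
end
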